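/- arXiv:2303.04937 — 3 statements merged into one kernel-verified Lean document; each statement's English description precedes it below -/
import Mathlib

section
/- Let X ⊂ ℝⁿ be a bounded open set and let u : X → ℝ be a nonnegative convex function which minimizes the functional Φ[v] := ∫_X ( (1/2)|∇v(x)|² + v(x) − x·∇v(x) ) dx among all nonnegative convex Lipschitz functions v : X → ℝ. Then u is of class C^{1,1} locally: u is differentiable on X and for every compact set K ⊂ X there is a constant L such that ‖∇u(x) − ∇u(y)‖ ≤ L‖x − y‖ for all x, y ∈ K. -/
open MeasureTheory RealInnerProductSpace

noncomputable section

/-- The principal's functional in the bilinear case `b(x,y) = x ⬝ y`,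
`Φ[v] = ∫_X (½|∇v|² + v - x·∇v) dx`. -/
def PhiCL {n : ℕ} (X : Set (EuclideanSpace ℝ (Fin n)))
    (v : EuclideanSpace ℝ (Fin n) → ℝ) : ℝ :=
  ∫ x in X, (1 / 2 * ‖gradient v x‖ ^ 2 + v x - ⟪x, gradient v x⟫)

section Regularity

open Set Filter Topology

section Subgradient

variable {E : Type*} [NormedAddCommGroup E] [InnerProductSpace ℝ E] [CompleteSpace E]

theorem ConvexOn.exists_subgradient {X : Set E} {u : E → ℝ} (hX : IsOpen X)
    (hu : ConvexOn ℝ X u) (hc : ContinuousOn u X) {x₀ : E} (hx₀ : x₀ ∈ X) :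
    ∃ p : E, ∀ x ∈ X, u x₀ + ⟪p, x - x₀⟫ ≤ u x := by
  have hopen : IsOpen {q : E × ℝ | q.1 ∈ X ∧ u q.1 < q.2} := by
    have h1 : ContinuousOn (fun q : E × ℝ => q.2 - u q.1) (X ×ˢ univ) :=
      continuousOn_snd.sub (hc.comp continuousOn_fst fun q hq => hq.1)
    have h2 := h1.isOpen_inter_preimage (hX.prod isOpen_univ) (isOpen_Ioi (a := (0 : ℝ)))
    convert h2 using 1
    ext q
    simp
  obtain ⟨f, hf⟩ := geometric_hahn_banach_open_point hu.convex_strict_epigraph hopen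
    (x := (x₀, u x₀)) (by simp)
  have hsplit : ∀ x t, f (x, t) = f (x, 0) + t * f (0, 1) := by
    intro x t
    have : (x, t) = (x, (0 : ℝ)) + t • ((0 : E), (1 : ℝ)) := by simp
    rw [this, map_add, map_smul, smul_eq_mul]
  have hneg : f (0, 1) < 0 := by
    have h := hf (x₀, u x₀ + 1) ⟨hx₀, by simp⟩
    rw [hsplit x₀ (u x₀ + 1), hsplit x₀ (u x₀)] at h
    linarith
  have hle : ∀ x ∈ X, f (x, 0) + u x * f (0, 1) ≤ f (x₀, 0) + u x₀ * f (0, 1) := by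
    intro x hx
    refine le_of_forall_pos_le_add fun ε hε => ?_
    have h := hf (x, u x + ε / (-f (0, 1))) ⟨hx, by
      have : 0 < ε / (-f (0, 1)) := div_pos hε (by linarith)
      simpa using this⟩
    rw [hsplit x, hsplit x₀] at h
    have : ε / (-f (0, 1)) * f (0, 1) = -ε := by
      rw [div_mul_eq_mul_div, div_eq_iff (neg_pos.2 hneg).ne']
      ring
    nlinarith
  set g : StrongDual ℝ E := f.comp (ContinuousLinearMap.inl ℝ E ℝ) with hg
  have hgx : ∀ x, g x = f (x, 0) := fun x => rfl
  refine ⟨(InnerProductSpace.toDual ℝ E).symm ((-f (0, 1))⁻¹ • g), fun x hx => ?_⟩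
  rw [InnerProductSpace.toDual_symm_apply]
  have h := hle x hx
  have hpos : 0 < -f (0, 1) := by linarith
  rw [← hgx, ← hgx] at h
  have h3 : ((-f (0, 1))⁻¹ • g) (x - x₀) = (g x - g x₀) / (-f (0, 1)) := by
    simp [div_eq_inv_mul, mul_sub]
  rw [h3, ← le_sub_iff_add_le', div_le_iff₀ hpos]
  linarith

theorem norm_le_of_subgradient {E : Type*} [NormedAddCommGroup E] [InnerProductSpace ℝ E]
    {X : Set E} {u : E → ℝ} {K : NNReal} (hX : IsOpen X)
    (hu : LipschitzWith K u) {x₀ p : E} (hx₀ : x₀ ∈ X)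
    (hp : ∀ x ∈ X, u x₀ + ⟪p, x - x₀⟫ ≤ u x) : ‖p‖ ≤ K := by
  have hev : ∀ᶠ t : ℝ in 𝓝 0, x₀ + t • p ∈ X := by
    have : ContinuousAt (fun t : ℝ => x₀ + t • p) 0 := by fun_prop
    exact this.eventually_mem (hX.mem_nhds (by simpa using hx₀))
  obtain ⟨t, ht, ht0⟩ := ((hev.filter_mono nhdsWithin_le_nhds).and
    (self_mem_nhdsWithin (s := Ioi (0 : ℝ)))).exists
  have ht0 : 0 < t := ht0
  have h1 := hp _ ht
  have h2 := hu.dist_le_mul (x₀ + t • p) x₀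
  rw [Real.dist_eq, dist_eq_norm] at h2
  simp only [add_sub_cancel_left, inner_smul_right, real_inner_self_eq_norm_sq, norm_smul,
    Real.norm_eq_abs, abs_of_pos ht0] at h1 h2
  have h3 := le_abs_self (u (x₀ + t • p) - u x₀)
  by_contra hcon
  push Not at hcon
  have hp0 : 0 < ‖p‖ := lt_of_le_of_lt K.2 hcon
  have : t * ‖p‖ * (‖p‖ - K) ≤ 0 := by nlinarith
  have : 0 < t * ‖p‖ * (‖p‖ - K) := by
    have : 0 < ‖p‖ - K := by linarith
    positivity
  linarith

end Subgradient

section Gradient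

variable {n : ℕ}

local notation "𝔼" => EuclideanSpace ℝ (Fin n)

theorem LipschitzWith.norm_gradient_le {E : Type*} [NormedAddCommGroup E] [InnerProductSpace ℝ E]
    [CompleteSpace E] {W : E → ℝ} {K : NNReal} (hW : LipschitzWith K W) (x : E) :
    ‖gradient W x‖ ≤ K := by
  rw [gradient, LinearIsometryEquiv.norm_map]
  exact norm_fderiv_le_of_lipschitz ℝ hW

theorem measurable_gradient (W : 𝔼 → ℝ) : Measurable (gradient W) :=
  (InnerProductSpace.toDual ℝ 𝔼).symm.continuous.measurable.comp (measurable_fderiv ℝ W)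

theorem integrableOn_comp_gradient {X : Set 𝔼} (hXo : IsOpen X) (hX : Bornology.IsBounded X)
    {W : 𝔼 → ℝ} {K : NNReal} (hW : LipschitzWith K W) {F : 𝔼 × 𝔼 → ℝ} (hF : Continuous F) :
    IntegrableOn (fun x => F (x, gradient W x)) X := by
  have hc : IsCompact (closure X ×ˢ Metric.closedBall (0 : 𝔼) K) :=
    hX.isCompact_closure.prod (isCompact_closedBall _ _)
  obtain ⟨C, hC⟩ := hc.exists_bound_of_continuousOn hF.continuousOn
  refine Measure.integrableOn_of_bounded (M := C) hX.measure_lt_top.ne ?_ ?_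
  · exact (hF.measurable.comp
      (measurable_id.prodMk (measurable_gradient W))).aestronglyMeasurable
  · refine (ae_restrict_mem hXo.measurableSet).mono fun x hx => hC _ ⟨subset_closure hx, ?_⟩
    simpa using hW.norm_gradient_le x

theorem integrableOn_of_continuous {X : Set 𝔼} (hX : Bornology.IsBounded X)
    {F : 𝔼 → ℝ} (hF : Continuous F) : IntegrableOn F X :=
  (hF.continuousOn.integrableOn_compact hX.isCompact_closure).mono_set subset_closure

/-- Integrated form of `div ((z - x) W) ≤ 0` up to the boundary for a domain star-shaped
about `z` and `W ≥ 0`. -/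
theorem integral_inner_sub_gradient_le {X : Set 𝔼} (hXo : IsOpen X)
    (hX : Bornology.IsBounded X) (hXc : Convex ℝ X) {W : 𝔼 → ℝ} {K : NNReal}
    (hW : LipschitzWith K W) (hW0 : ∀ x, 0 ≤ W x) {z : 𝔼} (hz : z ∈ X) :
    ∫ x in X, ⟪z - x, gradient W x⟫ ≤ n * ∫ x in X, W x := by
  set t : ℕ → ℝ := fun k => 1 / ((k : ℝ) + 2) with ht
  have ht0 : ∀ k, 0 < t k := fun k => by simp only [ht]; positivity
  have ht1 : ∀ k, t k < 1 := fun k => by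
    simp only [ht]; rw [div_lt_one (by positivity)]; linarith [(Nat.cast_nonneg k : (0 : ℝ) ≤ k)]
  have htlim : Tendsto t atTop (𝓝 0) := by
    have := (tendsto_const_div_atTop_nhds_zero_nat (1 : ℝ)).comp (tendsto_add_atTop_nat 2)
    refine this.congr fun k => ?_
    simp [ht]
  set T : ℕ → 𝔼 → 𝔼 := fun k x => x + t k • (z - x) with hT
  have hTX : ∀ k, T k '' X ⊆ X := by
    rintro k _ ⟨x, hx, rfl⟩
    exact hXc.add_smul_sub_mem hx hz ⟨(ht0 k).le, (ht1 k).le⟩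
  have hscale : ∀ k, (1 - t k) ^ n * ∫ x in X, W (T k x) ≤ ∫ x in X, W x := by
    intro k
    have hd : ∀ x ∈ X, HasFDerivWithinAt (T k)
        ((1 - t k) • ContinuousLinearMap.id ℝ 𝔼) X x := by
      intro x _
      have h1 : HasFDerivAt (T k) (ContinuousLinearMap.id ℝ 𝔼 +
          t k • (0 - ContinuousLinearMap.id ℝ 𝔼)) x :=
        (hasFDerivAt_id x).add (((hasFDerivAt_const z x).sub (hasFDerivAt_id x)).const_smul (t k))
      convert h1.hasFDerivWithinAt using 1
      module
    have hinj : InjOn (T k) X := by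
      intro x _ y _ hxy
      have h1 : (1 - t k) • (x - y) = 0 := by
        have : T k x - T k y = 0 := sub_eq_zero.2 hxy
        rw [← this]; simp only [hT]; module
      have := (smul_eq_zero.1 h1).resolve_left (by linarith [ht1 k])
      exact sub_eq_zero.1 this
    have h := integral_image_eq_integral_abs_det_fderiv_smul volume hXo.measurableSet hd hinj W
    have hdet : |((1 - t k) • ContinuousLinearMap.id ℝ 𝔼).det| = (1 - t k) ^ n := by
      rw [ContinuousLinearMap.det, ContinuousLinearMap.toLinearMap_smul, LinearMap.det_smul]
      simp [abs_of_pos (sub_pos.2 (ht1 k))]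
    rw [hdet] at h
    simp only [smul_eq_mul] at h
    rw [integral_const_mul] at h
    rw [← h]
    exact setIntegral_mono_set (integrableOn_of_continuous hX hW.continuous)
      (ae_of_all _ hW0) (hTX k).eventuallyLE
  have hTc : ∀ k, Continuous (T k) := fun k => by simp only [hT]; fun_prop
  have hWT : ∀ k, IntegrableOn (fun x => W (T k x)) X := fun k =>
    integrableOn_of_continuous hX (hW.continuous.comp (hTc k))
  have hle : ∀ k, ∫ x in X, ((W (T k x) - W x) / t k - n * W (T k x)) ≤ 0 := by
    intro k
    have hWi := integrableOn_of_continuous hX hW.continuous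
    have hdiff : IntegrableOn (fun x => (W (T k x) - W x) / t k) X :=
      ((hWT k).sub hWi).div_const _
    rw [integral_sub hdiff ((hWT k).const_mul _), integral_div,
      integral_sub (hWT k) hWi, integral_const_mul]
    have hb : 1 - n * t k ≤ (1 - t k) ^ n := by
      have := one_add_mul_le_pow (a := -t k) (by linarith [ht1 k]) n
      rwa [mul_neg, ← sub_eq_add_neg, ← sub_eq_add_neg] at this
    have hI : 0 ≤ ∫ x in X, W (T k x) := integral_nonneg fun x => hW0 _
    have h2 := mul_le_mul_of_nonneg_right hb hI
    have h3 := hscale k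
    rw [sub_nonpos, div_le_iff₀ (ht0 k)]
    linarith
  obtain ⟨R, hR⟩ := hX.isCompact_closure.exists_bound_of_continuousOn
    (f := fun x => ‖z - x‖) (by fun_prop)
  have hlim : Tendsto (fun k => ∫ x in X, ((W (T k x) - W x) / t k - n * W (T k x))) atTop
      (𝓝 (∫ x in X, (⟪z - x, gradient W x⟫ - n * W x))) := by
    refine tendsto_integral_of_dominated_convergence
      (fun x => K * R + n * (|W x| + K * R)) ?_ ?_ ?_ ?_
    · intro k
      have hc : Continuous (fun x => (W (T k x) - W x) / t k - n * W (T k x)) := by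
        have := hW.continuous.comp (hTc k)
        have := hW.continuous
        simp only [Function.comp_def] at *
        fun_prop
      exact hc.aestronglyMeasurable
    · have : Continuous (fun x => K * R + n * (|W x| + K * R)) := by
        have := hW.continuous
        fun_prop
      exact integrableOn_of_continuous hX this
    · intro k
      refine (ae_restrict_mem hXo.measurableSet).mono fun x hx => ?_
      have h1 : |W (T k x) - W x| ≤ K * R * t k := by
        have := hW.dist_le_mul (T k x) x
        rw [Real.dist_eq, dist_eq_norm] at this
        have h2 : T k x - x = t k • (z - x) := by simp [hT]
        rw [h2, norm_smul, Real.norm_eq_abs, abs_of_pos (ht0 k)] at this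
        have h3 := hR x (subset_closure hx)
        rw [norm_norm] at h3
        calc _ ≤ _ := this
          _ ≤ K * (t k * R) := by have := (ht0 k).le; gcongr
          _ = _ := by ring
      have hKR : 0 ≤ K * R := by
        have h3 := hR x (subset_closure hx)
        rw [norm_norm] at h3
        exact mul_nonneg K.2 ((norm_nonneg _).trans h3)
      have h4 : |W (T k x)| ≤ |W x| + K * R := by
        have h5 : |W (T k x)| ≤ |W x| + |W (T k x) - W x| := by
          have := abs_add_le (W x) (W (T k x) - W x)
          simpa using this
        have := ht1 k
        nlinarith
      calc ‖(W (T k x) - W x) / t k - n * W (T k x)‖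
          ≤ ‖(W (T k x) - W x) / t k‖ + ‖n * W (T k x)‖ := norm_sub_le _ _
        _ ≤ _ := by
          rw [norm_div, norm_mul, Real.norm_eq_abs, Real.norm_eq_abs, Real.norm_eq_abs,
            Real.norm_eq_abs, abs_of_pos (ht0 k), Nat.abs_cast]
          gcongr
          rw [div_le_iff₀ (ht0 k)]
          exact h1
    · filter_upwards [ae_restrict_of_ae (s := X) (hW.ae_differentiableAt (μ := volume))] with x hx
      refine Tendsto.sub ?_ (Tendsto.const_mul _ ?_)
      · have h1 : HasDerivAt (fun s : ℝ => W (x + s • (z - x))) ⟪z - x, gradient W x⟫ 0 := by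
          have h2 : HasDerivAt (fun s : ℝ => x + s • (z - x)) (z - x) 0 := by
            simpa using ((hasDerivAt_id (0 : ℝ)).smul_const (z - x)).const_add x
          have h3 : HasFDerivAt W (fderiv ℝ W x) (x + (0 : ℝ) • (z - x)) := by
            simpa using hx.hasFDerivAt
          have h4 := h3.comp_hasDerivAt (0 : ℝ) h2
          rw [real_inner_comm, inner_gradient_left]
          exact h4
        have h5 := h1.tendsto_slope_zero
        have h6 : Tendsto t atTop (𝓝[≠] 0) :=
          tendsto_nhdsWithin_iff.2 ⟨htlim, Eventually.of_forall fun k => (ht0 k).ne'⟩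
        refine (h5.comp h6).congr fun k => ?_
        simp [hT, div_eq_inv_mul]
      · have : Tendsto (fun k => T k x) atTop (𝓝 (x + (0 : ℝ) • (z - x))) :=
          tendsto_const_nhds.add (htlim.smul_const _)
        rw [zero_smul, add_zero] at this
        exact (hW.continuous.tendsto x).comp this
  have h := le_of_tendsto' hlim hle
  rw [integral_sub, integral_const_mul] at h
  · linarith
  · exact integrableOn_comp_gradient hXo hX hW (F := fun q => ⟪z - q.1, q.2⟫) (by fun_prop)
  · exact (integrableOn_of_continuous hX hW.continuous).const_mul _

theorem gradient_max_zero_of_nonpos {w : 𝔼 → ℝ} {x : 𝔼} (hx : w x ≤ 0) :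
    gradient (fun y => max (w y) 0) x = 0 := by
  have h : IsLocalMin (fun y => max (w y) 0) x :=
    Eventually.of_forall fun _ => by simp [max_eq_right hx]
  rw [gradient, h.fderiv_eq_zero, map_zero]

theorem max_zero_eventuallyEq {w : 𝔼 → ℝ} (hw : Continuous w) {x : 𝔼} (hx : 0 < w x) :
    (fun y => max (w y) 0) =ᶠ[𝓝 x] w :=
  (hw.continuousAt.eventually_const_lt hx).mono fun _ hy => max_eq_left hy.le

theorem ConcaveOn.le_add_inner_gradient {X : Set 𝔼} {w : 𝔼 → ℝ}
    (hw : ConcaveOn ℝ X w) {x y : 𝔼} (hx : x ∈ X) (hy : y ∈ X) (hd : DifferentiableAt ℝ w x) :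
    w y ≤ w x + ⟪gradient w x, y - x⟫ := by
  have h1 : HasDerivAt (fun s : ℝ => w (x + s • (y - x))) ⟪gradient w x, y - x⟫ 0 := by
    have h2 : HasDerivAt (fun s : ℝ => x + s • (y - x)) (y - x) 0 := by
      simpa using ((hasDerivAt_id (0 : ℝ)).smul_const (y - x)).const_add x
    have h3 : HasFDerivAt w (fderiv ℝ w x) (x + (0 : ℝ) • (y - x)) := by
      simpa using hd.hasFDerivAt
    have h4 := h3.comp_hasDerivAt (0 : ℝ) h2
    rw [inner_gradient_left]
    exact h4
  have h5 := h1.tendsto_slope_zero_right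
  have h6 : w y - w x ≤ ⟪gradient w x, y - x⟫ := by
    refine ge_of_tendsto h5 ?_
    filter_upwards [Ioo_mem_nhdsGT (zero_lt_one' ℝ)] with s hs
    have h7 := hw.2 hx hy (sub_nonneg.2 hs.2.le) hs.1.le (by ring)
    have h8 : (1 - s) • x + s • y = x + s • (y - x) := by module
    rw [h8] at h7
    simp only [smul_eq_mul, zero_add, zero_smul, add_zero] at h7 ⊢
    rw [inv_mul_eq_div, le_div_iff₀ hs.1]
    linarith
  linarith

theorem ConcaveOn.le_add_inner_gradient_max_zero {X : Set 𝔼} {w : 𝔼 → ℝ} (hc : Continuous w)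
    (hw : ConcaveOn ℝ X w) {x y : 𝔼} (hx : x ∈ X) (hy : y ∈ X) (hpos : 0 < w x)
    (hd : DifferentiableAt ℝ (fun z => max (w z) 0) x) :
    w y ≤ w x + ⟪gradient (fun z => max (w z) 0) x, y - x⟫ := by
  have h := max_zero_eventuallyEq hc hpos
  rw [h.gradient_eq]
  exact hw.le_add_inner_gradient hx hy (h.differentiableAt_iff.1 hd)

theorem integral_inner_gradient_max_zero_le {X : Set 𝔼} (hXo : IsOpen X)
    (hX : Bornology.IsBounded X) (hXc : Convex ℝ X) {w : 𝔼 → ℝ} {K : NNReal}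
    (hwl : LipschitzWith K w) (hw : ConcaveOn ℝ X w) {x₀ : 𝔼} {δ : ℝ} (hδ : 0 < δ)
    (hball : Metric.ball x₀ δ ⊆ X) (h0 : 0 ≤ w x₀) (c : 𝔼) :
    ∫ x in X, ⟪c - x, gradient (fun z => max (w z) 0) x⟫ ≤
      (n + (n + 1) * (2 * (‖c - x₀‖ + 1) / δ)) * ∫ x in X, max (w x) 0 := by
  set W : 𝔼 → ℝ := fun z => max (w z) 0 with hWdef
  have hW : LipschitzWith K W := hwl.max_const 0
  have hW0 : ∀ x, 0 ≤ W x := fun x => le_max_right _ _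
  have hx₀ : x₀ ∈ X := hball (Metric.mem_ball_self hδ)
  set e := c - x₀ with he
  set η := δ / (2 * (‖e‖ + 1)) with hη
  have hη0 : 0 < η := by positivity
  have hz : x₀ + η • e ∈ X := by
    apply hball
    rw [Metric.mem_ball, dist_eq_norm, add_sub_cancel_left, norm_smul, Real.norm_eq_abs,
      abs_of_pos hη0, hη, div_mul_eq_mul_div, div_lt_iff₀ (by positivity)]
    nlinarith [norm_nonneg e]
  have hgi : ∀ a : 𝔼, IntegrableOn (fun x => ⟪a - x, gradient W x⟫) X := fun a =>
    integrableOn_comp_gradient hXo hX hW (F := fun q => ⟪a - q.1, q.2⟫) (by fun_prop)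
  have hgi' : ∀ a : 𝔼, IntegrableOn (fun x => ⟪a, gradient W x⟫) X := fun a =>
    integrableOn_comp_gradient hXo hX hW (F := fun q => ⟪a, q.2⟫) (by fun_prop)
  have h1 := integral_inner_sub_gradient_le hXo hX hXc hW hW0 hz
  have h1' := integral_inner_sub_gradient_le hXo hX hXc hW hW0 hx₀
  have h2 : ∫ x in X, ⟪x₀ + η • e - x, gradient W x⟫ =
      (∫ x in X, ⟪x₀ - x, gradient W x⟫) + η * ∫ x in X, ⟪e, gradient W x⟫ := by
    rw [← integral_const_mul, ← integral_add (hgi x₀) ((hgi' e).const_mul η)]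
    refine integral_congr_ae (ae_of_all _ fun x => ?_)
    simp only [inner_sub_left, inner_add_left, inner_smul_left]
    simp only [conj_trivial]
    ring
  have h3 : ∫ x in X, ⟪c - x, gradient W x⟫ =
      (∫ x in X, ⟪x₀ - x, gradient W x⟫) + ∫ x in X, ⟪e, gradient W x⟫ := by
    rw [← integral_add (hgi x₀) (hgi' e)]
    refine integral_congr_ae (ae_of_all _ fun x => ?_)
    simp only [he, inner_sub_left]
    ring
  have h4 : -∫ x in X, W x ≤ ∫ x in X, ⟪x₀ - x, gradient W x⟫ := by
    rw [← integral_neg]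
    refine integral_mono_ae (integrableOn_of_continuous hX hW.continuous).neg (hgi x₀) ?_
    filter_upwards [ae_restrict_of_ae (s := X) (hW.ae_differentiableAt (μ := volume)),
      ae_restrict_mem hXo.measurableSet] with x hd hx
    rcases le_or_gt (w x) 0 with hle | hgt
    · rw [hWdef, gradient_max_zero_of_nonpos hle, inner_zero_right]
      exact neg_nonpos.2 (hW0 x)
    · have := hw.le_add_inner_gradient_max_zero hwl.continuous hx hx₀ hgt hd
      rw [real_inner_comm]
      simp only [hWdef, max_eq_left hgt.le]
      linarith
  have h5 : ∫ x in X, ⟪e, gradient W x⟫ ≤ (n + 1) * (2 * (‖e‖ + 1) / δ) * ∫ x in X, W x := by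
    have h6 : η * ∫ x in X, ⟪e, gradient W x⟫ ≤ (n + 1) * ∫ x in X, W x := by linarith
    have h7 : 2 * (‖e‖ + 1) / δ = η⁻¹ := by rw [hη, inv_div]
    rw [h7]
    calc _ = η⁻¹ * (η * ∫ x in X, ⟪e, gradient W x⟫) := by field_simp
      _ ≤ η⁻¹ * ((n + 1) * ∫ x in X, W x) := by gcongr
      _ = _ := by ring
  rw [h3]
  linarith

/-- The class of competitors of the principal's problem. -/
def IsAdmissible (X : Set 𝔼) (v : 𝔼 → ℝ) : Prop :=
  (∀ x ∈ X, 0 ≤ v x) ∧ ConvexOn ℝ X v ∧ ∃ K : NNReal, LipschitzOnWith K v X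

theorem lipschitzWith_affine_sub {u : 𝔼 → ℝ} {K : NNReal} (hu : LipschitzWith K u)
    (c : 𝔼) (b : ℝ) : ∃ K' : NNReal, LipschitzWith K' (fun x => ⟪c, x⟫ + b - u x) :=
  ⟨_, ((innerSL ℝ c).lipschitz.add (LipschitzWith.const b)).sub hu⟩

theorem concaveOn_affine_sub {X : Set 𝔼} {u : 𝔼 → ℝ} (hu : ConvexOn ℝ X u)
    (c : 𝔼) (b : ℝ) : ConcaveOn ℝ X (fun x => ⟪c, x⟫ + b - u x) :=
  (((innerSL ℝ c).toLinearMap.concaveOn hu.1).add_const b).sub hu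

theorem half_integral_sq_gradient_le {X : Set 𝔼} (hXo : IsOpen X)
    (hX : Bornology.IsBounded X) {u : 𝔼 → ℝ} {K : NNReal} (hul : LipschitzWith K u)
    (hu0 : ∀ x ∈ X, 0 ≤ u x) (hu : ConvexOn ℝ X u)
    (hmin : ∀ v, IsAdmissible X v → PhiCL X u ≤ PhiCL X v) (c : 𝔼) (b : ℝ) :
    1 / 2 * ∫ x in X, ‖gradient (fun z => max (⟪c, z⟫ + b - u z) 0) x‖ ^ 2 ≤
      (∫ x in X, ⟪c - x, gradient (fun z => max (⟪c, z⟫ + b - u z) 0) x⟫) +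
        ∫ x in X, max (⟪c, x⟫ + b - u x) 0 := by
  obtain ⟨K', hw⟩ := lipschitzWith_affine_sub hul c b
  set w : 𝔼 → ℝ := fun x => ⟪c, x⟫ + b - u x with hwdef
  set W : 𝔼 → ℝ := fun z => max (w z) 0 with hWdef
  have hW : LipschitzWith K' W := hw.max_const 0
  have hW0 : ∀ x, 0 ≤ W x := fun x => le_max_right _ _
  have hv : LipschitzWith (K + K') (fun x => u x + W x) := hul.add hW
  have hvadm : IsAdmissible X (fun x => u x + W x) := by
    refine ⟨fun x hx => add_nonneg (hu0 x hx) (hW0 x), ?_, _, hv.lipschitzOnWith⟩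
    have h1 : ConvexOn ℝ X (fun x => ⟪c, x⟫ + b) :=
      ((innerSL ℝ c).toLinearMap.convexOn hu.1).add_const b
    refine (h1.sup hu).congr fun x _ => ?_
    simp only [Pi.sup_apply, hWdef, hwdef]
    rw [← max_add_add_left, max_comm, add_zero, add_sub_cancel, max_comm]
  have hPhi : ∀ {v : 𝔼 → ℝ} {L : NNReal}, LipschitzWith L v → IntegrableOn
      (fun x => 1 / 2 * ‖gradient v x‖ ^ 2 + v x - ⟪x, gradient v x⟫) X := by
    intro v L hv
    have hc := hv.continuous
    exact integrableOn_comp_gradient hXo hX hv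
      (F := fun q => 1 / 2 * ‖q.2‖ ^ 2 + v q.1 - ⟪q.1, q.2⟫) (by fun_prop)
  have hmain := sub_nonneg.2 (hmin _ hvadm)
  rw [PhiCL, PhiCL, ← integral_sub (hPhi hv) (hPhi hul)] at hmain
  have hcongr : ∫ x in X, ((1 / 2 * ‖gradient (fun x => u x + W x) x‖ ^ 2 + (u x + W x) -
        ⟪x, gradient (fun x => u x + W x) x⟫) -
        (1 / 2 * ‖gradient u x‖ ^ 2 + u x - ⟪x, gradient u x⟫)) =
      ∫ x in X, (⟪c - x, gradient W x⟫ + W x - 1 / 2 * ‖gradient W x‖ ^ 2) := by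
    refine integral_congr_ae ?_
    filter_upwards [ae_restrict_of_ae (s := X) (hW.ae_differentiableAt (μ := volume)),
      ae_restrict_of_ae (s := X) (hul.ae_differentiableAt (μ := volume))] with x hdW hdu
    have hadd : gradient (fun x => u x + W x) x = gradient u x + gradient W x := by
      simp only [gradient]
      rw [fderiv_fun_add hdu hdW, map_add]
    have horth : ⟪gradient u x, gradient W x⟫ = ⟪c - gradient W x, gradient W x⟫ := by
      rcases le_or_gt (w x) 0 with hle | hgt
      · have : gradient W x = 0 := gradient_max_zero_of_nonpos hle
        simp [this]
      · have h1 : gradient W x = gradient w x := (max_zero_eventuallyEq hw.continuous hgt).gradient_eq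
        have h2 : gradient w x = c - gradient u x := by
          refine HasGradientAt.gradient ?_
          rw [hasGradientAt_iff_hasFDerivAt, map_sub, toDual_gradient]
          exact ((innerSL ℝ c).hasFDerivAt.add_const b).sub hdu.hasFDerivAt
        rw [h1, h2, sub_sub_cancel]
    rw [hadd, norm_add_sq_real, horth]
    simp only [inner_add_right, inner_sub_left, real_inner_self_eq_norm_sq]
    ring
  rw [hcongr] at hmain
  have hi1 : IntegrableOn (fun x => ⟪c - x, gradient W x⟫) X :=
    integrableOn_comp_gradient hXo hX hW (F := fun q => ⟪c - q.1, q.2⟫) (by fun_prop)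
  have hi2 : IntegrableOn (fun x => 1 / 2 * ‖gradient W x‖ ^ 2) X :=
    integrableOn_comp_gradient hXo hX hW (F := fun q => 1 / 2 * ‖q.2‖ ^ 2) (by fun_prop)
  have hi3 := integrableOn_of_continuous hX hW.continuous
  have hi4 : IntegrableOn (fun x => ⟪c - x, gradient W x⟫ + W x) X := hi1.add hi3
  rw [integral_sub hi4 hi2, integral_add hi1 hi3, integral_const_mul] at hmain
  linarith

/-- A lower bound for the gradient on a homothetic copy of the section `{w > 0}`. -/
theorem le_norm_gradient_of_section {X : Set 𝔼} {ψ w : 𝔼 → ℝ} (hψ : ConvexOn ℝ X ψ)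
    (hψ0 : ∀ x ∈ X, 0 ≤ ψ x) {x₀ d q z : 𝔼} {h : ℝ} (hh : 0 < h) (hx₀ : x₀ ∈ X)
    (hψx₀ : ψ x₀ = 0) (hd : x₀ - d ∈ X) (hψd : ψ (x₀ - d) ≤ h) (hqd : ⟪q, d⟫ = h)
    (hψq : ∀ x ∈ X, ⟪q, x - x₀⟫ - h ≤ ψ x)
    (hw : ∀ x, w x = h + 1 / 2 * ⟪q, x - x₀⟫ - ψ x) (hc : Continuous w)
    (hwc : ConcaveOn ℝ X w) (hz : z ∈ X) (hwz : 0 < w z)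
    (hdiff : DifferentiableAt ℝ (fun x => max (w x) 0)
      (AffineMap.homothety (x₀ - (1 / 2 : ℝ) • d) (1 / 24 : ℝ) z)) :
    h / 5 ≤ ‖gradient (fun x => max (w x) 0)
      (AffineMap.homothety (x₀ - (1 / 2 : ℝ) • d) (1 / 24 : ℝ) z)‖ * ‖d‖ := by
  set m : 𝔼 := x₀ - (1 / 2 : ℝ) • d with hm
  set y' := AffineMap.homothety m (1 / 24 : ℝ) z with hy'
  have hy'eq : y' = (23 / 24 : ℝ) • m + (1 / 24 : ℝ) • z := by
    rw [hy', AffineMap.homothety_apply, vsub_eq_sub, vadd_eq_add]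
    module
  set y := (23 / 24 : ℝ) • x₀ + (1 / 24 : ℝ) • z with hy
  have hmeq : m = (1 / 2 : ℝ) • x₀ + (1 / 2 : ℝ) • (x₀ - d) := by rw [hm]; module
  have hmX : m ∈ X := hmeq ▸ hψ.1 hx₀ hd (by norm_num) (by norm_num) (by norm_num)
  have hy'X : y' ∈ X := hy'eq ▸ hψ.1 hmX hz (by norm_num) (by norm_num) (by norm_num)
  have hyX : y ∈ X := hψ.1 hx₀ hz (by norm_num) (by norm_num) (by norm_num)
  have hψm : ψ m ≤ h / 2 := by
    have := hψ.2 hx₀ hd (show (0 : ℝ) ≤ 1 / 2 by norm_num) (show (0 : ℝ) ≤ 1 / 2 by norm_num)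
      (by norm_num)
    rw [← hmeq, hψx₀] at this
    simp only [smul_eq_mul] at this
    linarith
  have hz1 := hψ0 z hz
  have hz2 := hψq z hz
  have hz3 := hw z
  have hψy' : ψ y' ≤ 23 / 24 * ψ m + 1 / 24 * ψ z := by
    rw [hy'eq]
    exact hψ.2 hmX hz (by norm_num) (by norm_num) (by norm_num)
  have hwy : 23 / 24 * h ≤ w y := by
    have h1 : 23 / 24 * w x₀ + 1 / 24 * w z ≤ w y :=
      hwc.2 hx₀ hz (by norm_num) (by norm_num) (by norm_num)
    have h2 : w x₀ = h := by rw [hw, hψx₀, sub_self, inner_zero_right]; ring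
    linarith
  have hqy' : ⟪q, y' - x₀⟫ = -(23 / 48) * h + 1 / 24 * ⟪q, z - x₀⟫ := by
    have : y' - x₀ = (-(23 / 48) : ℝ) • d + (1 / 24 : ℝ) • (z - x₀) := by
      rw [hy'eq, hm]; module
    rw [this, inner_add_right, inner_smul_right, inner_smul_right, hqd]
  have hwy' := hw y'
  rw [hqy'] at hwy'
  have hpos : 0 < w y' := by linarith
  have hup : w y' ≤ 23 / 24 * h - h / 10 := by
    have := hψ0 y' hy'X
    linarith
  have hgrad := hwc.le_add_inner_gradient_max_zero hc hy'X hyX hpos hdiff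
  have hyy' : y - y' = (23 / 48 : ℝ) • d := by rw [hy, hy'eq, hm]; module
  rw [hyy', inner_smul_right] at hgrad
  have := real_inner_le_norm (gradient (fun x => max (w x) 0) y') d
  linarith

theorem sq_mul_volume_le_of_section {X : Set 𝔼} (hXo : IsOpen X) (hX : Bornology.IsBounded X)
    {ψ w : 𝔼 → ℝ} {K : NNReal} (hψ : ConvexOn ℝ X ψ)
    (hψ0 : ∀ x ∈ X, 0 ≤ ψ x) {x₀ d q : 𝔼} {h : ℝ} (hh : 0 < h) (hx₀ : x₀ ∈ X)
    (hψx₀ : ψ x₀ = 0) (hd : x₀ - d ∈ X) (hψd : ψ (x₀ - d) ≤ h) (hqd : ⟪q, d⟫ = h)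
    (hψq : ∀ x ∈ X, ⟪q, x - x₀⟫ - h ≤ ψ x)
    (hw : ∀ x, w x = h + 1 / 2 * ⟪q, x - x₀⟫ - ψ x) (hwl : LipschitzWith K w)
    (hwc : ConcaveOn ℝ X w) :
    (h / (5 * ‖d‖)) ^ 2 * ((1 / 24) ^ n * volume.real (X ∩ {x | 0 < w x})) ≤
      ∫ x in X, ‖gradient (fun x => max (w x) 0) x‖ ^ 2 := by
  set W : 𝔼 → ℝ := fun x => max (w x) 0 with hWdef
  have hW : LipschitzWith K W := hwl.max_const 0
  set S := X ∩ {x | 0 < w x} with hS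
  have hSo : IsOpen S := hXo.inter (isOpen_lt continuous_const hwl.continuous)
  set m : 𝔼 := x₀ - (1 / 2 : ℝ) • d with hm
  have hmeq : m = (1 / 2 : ℝ) • x₀ + (1 / 2 : ℝ) • (x₀ - d) := by rw [hm]; module
  have hmX : m ∈ X := hmeq ▸ hψ.1 hx₀ hd (by norm_num) (by norm_num) (by norm_num)
  set T := AffineMap.homothety m (1 / 24 : ℝ) '' S with hT
  have hTo : IsOpen T := AffineMap.homothety_isOpenMap m _ (by norm_num) _ hSo
  have hTX : T ⊆ X := by
    rintro _ ⟨z, hz, rfl⟩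
    have : AffineMap.homothety m (1 / 24 : ℝ) z = (23 / 24 : ℝ) • m + (1 / 24 : ℝ) • z := by
      rw [AffineMap.homothety_apply, vsub_eq_sub, vadd_eq_add]
      module
    rw [this]
    exact hψ.1 hmX hz.1 (by norm_num) (by norm_num) (by norm_num)
  have hTvol : volume.real T = (1 / 24) ^ n * volume.real S := by
    rw [measureReal_def, hT, Measure.addHaar_image_homothety, ENNReal.toReal_mul,
      ENNReal.toReal_ofReal (abs_nonneg _), abs_of_nonneg (by positivity), measureReal_def]
    simp
  have hdn : 0 < ‖d‖ := by
    rw [norm_pos_iff]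
    rintro rfl
    rw [inner_zero_right] at hqd
    exact hh.ne hqd
  have hgi : IntegrableOn (fun x => ‖gradient W x‖ ^ 2) X :=
    integrableOn_comp_gradient hXo hX hW (F := fun q => ‖q.2‖ ^ 2) (by fun_prop)
  calc (h / (5 * ‖d‖)) ^ 2 * ((1 / 24) ^ n * volume.real S)
      = ∫ _ in T, (h / (5 * ‖d‖)) ^ 2 := by
        rw [setIntegral_const, hTvol, smul_eq_mul, mul_comm]
    _ ≤ ∫ x in T, ‖gradient W x‖ ^ 2 := by
        refine setIntegral_mono_on_ae
          (integrableOn_const (hX.subset hTX).measure_lt_top.ne) (hgi.mono_set hTX)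
          hTo.measurableSet ?_
        filter_upwards [hW.ae_differentiableAt (μ := volume)] with x hdiff hx
        obtain ⟨z, hz, rfl⟩ := hx
        have := le_norm_gradient_of_section hψ hψ0 hh hx₀ hψx₀ hd hψd hqd hψq hw
          hwl.continuous hwc hz.1 hz.2 hdiff
        gcongr
        rw [div_le_iff₀ (by positivity)]
        linarith
    _ ≤ _ := setIntegral_mono_set hgi (ae_of_all _ fun x => sq_nonneg _) hTX.eventuallyLE

theorem integral_max_zero_le_of_section {X : Set 𝔼} (hXo : IsOpen X)
    (hX : Bornology.IsBounded X) {w : 𝔼 → ℝ} (hw : Continuous w) {M : ℝ}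
    (hM : ∀ x ∈ X, 0 < w x → w x ≤ M) :
    ∫ x in X, max (w x) 0 ≤ M * volume.real (X ∩ {x | 0 < w x}) := by
  set S := X ∩ {x | 0 < w x} with hS
  have hSo : IsOpen S := hXo.inter (isOpen_lt continuous_const hw)
  have hWc : Continuous (fun x => max (w x) 0) := by fun_prop
  have h1 : ∫ x in X, max (w x) 0 = ∫ x in S, max (w x) 0 := by
    refine setIntegral_eq_of_subset_of_forall_sdiff_eq_zero hXo.measurableSet inter_subset_left ?_
    intro x hx
    exact max_eq_right (not_lt.1 fun h => hx.2 ⟨hx.1, h⟩)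
  rw [h1]
  calc ∫ x in S, max (w x) 0 ≤ ∫ _ in S, M := by
        refine setIntegral_mono_on
          ((integrableOn_of_continuous hX hWc).mono_set inter_subset_left)
          (integrableOn_const (hX.subset inter_subset_left).measure_lt_top.ne)
          hSo.measurableSet ?_
        intro x hx
        rw [max_eq_left (le_of_lt hx.2)]
        exact hM x hx.1 hx.2
    _ = _ := by rw [setIntegral_const, smul_eq_mul, mul_comm]

theorem quadratic_growth {X : Set 𝔼} (hXo : IsOpen X)
    (hX : Bornology.IsBounded X) {u : 𝔼 → ℝ} {K : NNReal} (hul : LipschitzWith K u)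
    (hu0 : ∀ x ∈ X, 0 ≤ u x) (hu : ConvexOn ℝ X u)
    (hmin : ∀ v, IsAdmissible X v → PhiCL X u ≤ PhiCL X v) {δ : ℝ} (hδ : 0 < δ) :
    ∃ C : ℝ, 0 ≤ C ∧ ∀ x₀ p : 𝔼, Metric.ball x₀ δ ⊆ X →
      (∀ x ∈ X, u x₀ + ⟪p, x - x₀⟫ ≤ u x) →
      ∀ d, ‖d‖ < δ → u (x₀ + d) ≤ u x₀ + ⟪p, d⟫ + C * ‖d‖ ^ 2 := by
  obtain ⟨R, hR0, hR⟩ := hX.exists_pos_norm_le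
  set A : ℝ := n + (n + 1) * (2 * (2 * K + R + 1) / δ) + 1 with hA
  have hA0 : 0 ≤ A := by positivity
  refine ⟨150 * 24 ^ n * A, by positivity, fun x₀ p hball hp => ?_⟩
  have hx₀ : x₀ ∈ X := hball (Metric.mem_ball_self hδ)
  set ψ : 𝔼 → ℝ := fun x => u x - u x₀ - ⟪p, x - x₀⟫ with hψdef
  have hψ0 : ∀ x ∈ X, 0 ≤ ψ x := fun x hx => by
    have := hp x hx
    simp only [hψdef]; linarith
  have hψx₀ : ψ x₀ = 0 := by simp [hψdef]
  have hψ : ConvexOn ℝ X ψ := by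
    refine ((hu.sub ((innerSL ℝ p).toLinearMap.concaveOn hu.1)).add_const
      (⟪p, x₀⟫ - u x₀)).congr fun x _ => ?_
    simp only [hψdef, inner_sub_right, Pi.sub_apply, Pi.add_apply, ContinuousLinearMap.coe_coe,
      innerSL_apply_apply]
    ring
  have hpK := norm_le_of_subgradient hXo hul hx₀ hp
  have hmem : ∀ d : 𝔼, ‖d‖ < δ → x₀ + d ∈ X := fun d hd => hball (by simpa using hd)
  have key : ∀ d : 𝔼, ‖d‖ < δ → ψ (x₀ - d) ≤ ψ (x₀ + d) →
      ψ (x₀ + d) ≤ 150 * 24 ^ n * A * ‖d‖ ^ 2 := by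
    intro d hd hle
    set h := ψ (x₀ + d) with hh
    rcases (hψ0 _ (hmem d hd)).eq_or_lt with h0 | h0
    · rw [hh, ← h0]; positivity
    rw [← hh] at h0
    have hd' : x₀ - d ∈ X := by
      rw [sub_eq_add_neg]; exact hmem _ (by rwa [norm_neg])
    obtain ⟨p₁, hp₁⟩ := hu.exists_subgradient hXo hul.continuous.continuousOn (hmem d hd)
    have hp₁K := norm_le_of_subgradient hXo hul (hmem d hd) hp₁
    have hueq : u (x₀ + d) = u x₀ + ⟪p, d⟫ + h := by
      simp only [hh, hψdef, add_sub_cancel_left]; ring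
    have hslope : h ≤ ⟪p₁ - p, d⟫ := by
      have := hp₁ x₀ hx₀
      rw [sub_add_cancel_left, inner_neg_right, hueq] at this
      rw [inner_sub_left]
      linarith
    set θ := h / ⟪p₁ - p, d⟫ with hθ
    have hθ0 : 0 ≤ θ := by have := h0.trans_le hslope; positivity
    have hθ1 : θ ≤ 1 := div_le_one_of_le₀ hslope (h0.le.trans hslope)
    have hθd : θ * ⟪p₁ - p, d⟫ = h := div_mul_cancel₀ _ (h0.trans_le hslope).ne'
    set q := θ • (p₁ - p) with hq
    have hqi : ∀ x, ⟪q, x⟫ = θ * ⟪p₁ - p, x⟫ := fun x => by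
      rw [hq, real_inner_smul_left]
    have hqd : ⟪q, d⟫ = h := by rw [hqi, hθd]
    have hψq : ∀ x ∈ X, ⟪q, x - x₀⟫ - h ≤ ψ x := by
      intro x hx
      have h1 : h + ⟪p₁ - p, x - x₀⟫ - ⟪p₁ - p, d⟫ ≤ ψ x := by
        have h2 := hp₁ x hx
        have h3 : x - (x₀ + d) = (x - x₀) - d := by abel
        rw [h3, inner_sub_right, hueq] at h2
        simp only [hψdef]
        rw [inner_sub_left, inner_sub_left]
        linarith
      have h4 := mul_le_mul_of_nonneg_left h1 hθ0
      have h5 := mul_le_mul_of_nonneg_right hθ1 (hψ0 x hx)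
      rw [hqi]
      nlinarith
    set c := p + (1 / 2 : ℝ) • q with hc
    set b := u x₀ + h - ⟪c, x₀⟫ with hb
    have hcK : ‖c‖ ≤ 2 * K := by
      have h1 : ‖q‖ ≤ 2 * K := by
        rw [hq, norm_smul, Real.norm_eq_abs, abs_of_nonneg hθ0]
        have h2 : ‖p₁ - p‖ ≤ 2 * K := (norm_sub_le _ _).trans (by linarith)
        nlinarith [norm_nonneg (p₁ - p)]
      calc ‖c‖ ≤ ‖p‖ + ‖(1 / 2 : ℝ) • q‖ := norm_add_le _ _
        _ ≤ 2 * K := by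
          rw [norm_smul, Real.norm_eq_abs, abs_of_pos (by norm_num : (0 : ℝ) < 1 / 2)]
          linarith
    obtain ⟨K', hwl⟩ := lipschitzWith_affine_sub hul c b
    have hwc := concaveOn_affine_sub hu c b
    have henergy := half_integral_sq_gradient_le hXo hX hul hu0 hu hmin c b
    set w : 𝔼 → ℝ := fun x => ⟪c, x⟫ + b - u x with hwdef
    have hw : ∀ x, w x = h + 1 / 2 * ⟪q, x - x₀⟫ - ψ x := by
      intro x
      simp only [hwdef, hψdef, hb, hc, inner_sub_right, inner_add_left, real_inner_smul_left]
      ring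
    have hwx₀ : w x₀ = h := by rw [hw, hψx₀, sub_self, inner_zero_right]; ring
    have hcoef : ‖c - x₀‖ + 1 ≤ 2 * K + R + 1 := by
      have := norm_sub_le c x₀
      have := hR x₀ hx₀
      linarith
    have hdrift := integral_inner_gradient_max_zero_le hXo hX hu.1 hwl hwc hδ hball
      (hwx₀ ▸ h0.le) c
    have hI0 : 0 ≤ ∫ x in X, max (w x) 0 := integral_nonneg fun x => le_max_right _ _
    have hA' : (n + (n + 1) * (2 * (‖c - x₀‖ + 1) / δ)) * (∫ x in X, max (w x) 0) ≤
        (n + (n + 1) * (2 * (2 * K + R + 1) / δ)) * ∫ x in X, max (w x) 0 := by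
      gcongr
    have hlow := sq_mul_volume_le_of_section hXo hX hψ hψ0 h0 hx₀ hψx₀ hd' hle hqd hψq hw hwl hwc
    have hupp := integral_max_zero_le_of_section hXo hX hwl.continuous (M := 3 * h) (by
      intro x hx hpos
      have h1 := hw x
      have h2 := hψq x hx
      have h3 := hψ0 x hx
      linarith)
    set V := volume.real (X ∩ {x | 0 < w x}) with hV
    have hVpos : 0 < V := by
      have hSo : IsOpen (X ∩ {x | 0 < w x}) :=
        hXo.inter (isOpen_lt continuous_const hwl.continuous)
      have hne : (X ∩ {x | 0 < w x}).Nonempty := ⟨x₀, hx₀, by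
        change 0 < w x₀
        rwa [hwx₀]⟩
      exact ENNReal.toReal_pos (hSo.measure_pos volume hne).ne'
        (hX.subset inter_subset_left).measure_lt_top.ne
    have hfin : (h / (5 * ‖d‖)) ^ 2 * ((1 / 24) ^ n * V) ≤ 2 * (A * (3 * h * V)) := by
      have := mul_le_mul_of_nonneg_left hupp hA0
      rw [hA] at this ⊢
      linarith
    have hdn : 0 < ‖d‖ := by
      rw [norm_pos_iff]
      rintro rfl
      rw [inner_zero_right] at hqd
      exact h0.ne hqd
    have hfac : h * V * h ≤ h * V * (150 * 24 ^ n * A * ‖d‖ ^ 2) := by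
      calc h * V * h = (25 * ‖d‖ ^ 2 * 24 ^ n) *
            ((h / (5 * ‖d‖)) ^ 2 * ((1 / 24) ^ n * V)) := by
            rw [one_div, inv_pow]
            field_simp
            ring
        _ ≤ (25 * ‖d‖ ^ 2 * 24 ^ n) * (2 * (A * (3 * h * V))) := by gcongr
        _ = _ := by ring
    exact le_of_mul_le_mul_left hfac (by positivity)
  intro d hd
  have hψd : ψ (x₀ + d) ≤ 150 * 24 ^ n * A * ‖d‖ ^ 2 := by
    rcases le_total (ψ (x₀ - d)) (ψ (x₀ + d)) with hle | hle
    · exact key d hd hle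
    · have := key (-d) (by rwa [norm_neg]) (by rwa [sub_neg_eq_add, ← sub_eq_add_neg])
      rw [norm_neg, ← sub_eq_add_neg] at this
      exact hle.trans this
  simp only [hψdef, add_sub_cancel_left] at hψd
  linarith

theorem hasGradientAt_of_quadratic_growth {X : Set 𝔼} {u : 𝔼 → ℝ} {x₀ p : 𝔼} {δ C : ℝ}
    (hδ : 0 < δ) (hball : Metric.ball x₀ δ ⊆ X)
    (hp : ∀ x ∈ X, u x₀ + ⟪p, x - x₀⟫ ≤ u x)
    (hgrow : ∀ d, ‖d‖ < δ → u (x₀ + d) ≤ u x₀ + ⟪p, d⟫ + C * ‖d‖ ^ 2) :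
    HasGradientAt u p x₀ := by
  rw [hasGradientAt_iff_isLittleO_nhds_zero]
  have h1 : (fun d : 𝔼 => u (x₀ + d) - u x₀ - ⟪p, d⟫) =O[𝓝 0] fun d => ‖d‖ ^ 2 := by
    refine Asymptotics.IsBigO.of_bound C ?_
    filter_upwards [Metric.ball_mem_nhds (0 : 𝔼) hδ] with d hd
    have hd' : ‖d‖ < δ := by simpa using hd
    have h2 := hp (x₀ + d) (hball (by simpa using hd'))
    have h3 := hgrow d hd'
    rw [add_sub_cancel_left] at h2
    rw [Real.norm_eq_abs, Real.norm_eq_abs, abs_of_nonneg (by linarith),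
      abs_of_nonneg (by positivity)]
    linarith
  exact h1.trans_isLittleO (Asymptotics.isLittleO_norm_pow_id one_lt_two)

theorem norm_subgradient_sub_le {X : Set 𝔼} {u : 𝔼 → ℝ} {x y p q : 𝔼} {δ C : ℝ}
    (hx : x ∈ X) (hball : Metric.ball y δ ⊆ X)
    (hp : ∀ z ∈ X, u x + ⟪p, z - x⟫ ≤ u z) (hq : ∀ z ∈ X, u y + ⟪q, z - y⟫ ≤ u z)
    (hgrow : ∀ d, ‖d‖ < δ → u (y + d) ≤ u y + ⟪q, d⟫ + C * ‖d‖ ^ 2) (hC : 0 ≤ C)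
    (hne : x ≠ y)
    (hxy : 2 * ‖x - y‖ < δ) : ‖p - q‖ ≤ 4 * C * ‖x - y‖ := by
  have hr0 : 0 < ‖x - y‖ := norm_pos_iff.2 (sub_ne_zero.2 hne)
  rcases eq_or_ne p q with rfl | hpq
  · rw [sub_self, norm_zero]; positivity
  have hpos : 0 < ‖p - q‖ := norm_pos_iff.2 (sub_ne_zero.2 hpq)
  set r := ‖x - y‖ with hr
  set e := (r / ‖p - q‖) • (p - q) with he
  have hen : ‖e‖ = r := by
    rw [he, norm_smul, norm_div, norm_norm, Real.norm_eq_abs, abs_of_nonneg (norm_nonneg _),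
      div_mul_cancel₀ _ hpos.ne']
  have hei : ⟪p - q, e⟫ = r * ‖p - q‖ := by
    rw [he, inner_smul_right, real_inner_self_eq_norm_sq]
    field_simp
  set d := x - y + e with hd
  have hdn : ‖d‖ ≤ 2 * r := (norm_add_le _ _).trans (by rw [hen]; linarith)
  have hz : y + d ∈ X := hball (by simpa using hdn.trans_lt hxy)
  have h1 := hp _ hz
  have h2 := hq x hx
  have h3 := hgrow d (hdn.trans_lt hxy)
  have h4 : y + d - x = e := by rw [hd]; abel
  rw [h4] at h1
  have h5 : ⟪q, d⟫ = ⟪q, x - y⟫ + ⟪q, e⟫ := by rw [hd, inner_add_right]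
  rw [inner_sub_left] at hei
  have h6 : C * ‖d‖ ^ 2 ≤ C * (2 * r) ^ 2 := by gcongr
  have h7 : r * ‖p - q‖ ≤ r * (4 * C * r) := by nlinarith
  exact le_of_mul_le_mul_left h7 hr0

theorem differentiableAt_and_lipschitz_gradient_of_minimizer {X : Set 𝔼} (hXo : IsOpen X)
    (hX : Bornology.IsBounded X) {u : 𝔼 → ℝ} {K : NNReal} (hul : LipschitzWith K u)
    (hu0 : ∀ x ∈ X, 0 ≤ u x) (hu : ConvexOn ℝ X u)
    (hmin : ∀ v, IsAdmissible X v → PhiCL X u ≤ PhiCL X v) :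
    (∀ x ∈ X, DifferentiableAt ℝ u x) ∧
    ∀ s : Set 𝔼, IsCompact s → s ⊆ X →
      ∃ L : ℝ, ∀ x ∈ s, ∀ y ∈ s, ‖gradient u x - gradient u y‖ ≤ L * ‖x - y‖ := by
  have hsub : ∀ x ∈ X, ∃ p : 𝔼, ∀ y ∈ X, u x + ⟪p, y - x⟫ ≤ u y := fun x hx =>
    hu.exists_subgradient hXo hul.continuous.continuousOn hx
  refine ⟨fun x hx => ?_, fun s hs hsX => ?_⟩
  · obtain ⟨δ, hδ, hball⟩ := Metric.isOpen_iff.1 hXo x hx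
    obtain ⟨C, -, hC⟩ := quadratic_growth hXo hX hul hu0 hu hmin hδ
    obtain ⟨p, hp⟩ := hsub x hx
    exact (hasGradientAt_of_quadratic_growth hδ hball hp (hC x p hball hp)).differentiableAt
  · obtain ⟨δ, hδ, hthick⟩ := hs.exists_thickening_subset_open hXo hsX
    have hball : ∀ x ∈ s, Metric.ball x δ ⊆ X := fun x hx =>
      (Metric.ball_subset_thickening hx δ).trans hthick
    obtain ⟨C, hC0, hC⟩ := quadratic_growth hXo hX hul hu0 hu hmin hδ
    have hgrad : ∀ x ∈ s, ∀ z ∈ X, u x + ⟪gradient u x, z - x⟫ ≤ u z := by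
      intro x hx
      obtain ⟨p, hp⟩ := hsub x (hsX hx)
      rwa [(hasGradientAt_of_quadratic_growth hδ (hball x hx) hp
        (hC x p (hball x hx) hp)).gradient]
    refine ⟨4 * C + 4 * K / δ, fun x hx y hy => ?_⟩
    rcases eq_or_ne x y with rfl | hne
    · simp
    rcases lt_or_ge (2 * ‖x - y‖) δ with hlt | hge
    · have h1 := norm_subgradient_sub_le (hsX hx) (hball y hy) (hgrad x hx) (hgrad y hy)
        (hC y _ (hball y hy) (hgrad y hy)) hC0 hne hlt
      have h2 : 0 ≤ 4 * K / δ * ‖x - y‖ := by positivity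
      linarith
    · have h1 : ‖gradient u x - gradient u y‖ ≤ 2 * K :=
        (norm_sub_le _ _).trans (by
          linarith [hul.norm_gradient_le x, hul.norm_gradient_le y])
      have h2 : 2 * K ≤ 4 * K / δ * ‖x - y‖ := by
        rw [div_mul_eq_mul_div, le_div_iff₀ hδ]
        nlinarith [K.2]
      have h3 : 0 ≤ 4 * C * ‖x - y‖ := by positivity
      linarith

theorem PhiCL_congr {X : Set 𝔼} (hXo : IsOpen X) {u v : 𝔼 → ℝ} (h : EqOn u v X) :
    PhiCL X u = PhiCL X v := by
  refine setIntegral_congr_fun hXo.measurableSet fun x hx => ?_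
  have h1 : u =ᶠ[𝓝 x] v := h.eventuallyEq_of_mem (hXo.mem_nhds hx)
  simp only [h1.gradient_eq, h hx]

end Gradient

end Regularity

/-- **Caffarelli–Lions.** A nonnegative convex minimizer of
`Φ[v] = ∫_X (½|∇v|² + v - x·∇v)` among nonnegative convex Lipschitz functions on a
bounded open set `X ⊆ ℝⁿ` is locally `C^{1,1}`: it is differentiable on `X` and its
gradient is Lipschitz on each compact subset of `X`. -/
theorem caffarelli_lions_C11 {n : ℕ} (X : Set (EuclideanSpace ℝ (Fin n)))
    (hXopen : IsOpen X) (hXbdd : Bornology.IsBounded X)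
    (u : EuclideanSpace ℝ (Fin n) → ℝ)
    (hu_nonneg : ∀ x ∈ X, 0 ≤ u x)
    (hu_convex : ConvexOn ℝ X u)
    (hu_lip : ∃ K : NNReal, LipschitzOnWith K u X)
    (hu_min : ∀ v : EuclideanSpace ℝ (Fin n) → ℝ,
      (∀ x ∈ X, 0 ≤ v x) → ConvexOn ℝ X v → (∃ K : NNReal, LipschitzOnWith K v X) →
      PhiCL X u ≤ PhiCL X v) :
    (∀ x ∈ X, DifferentiableAt ℝ u x) ∧
    ∀ K : Set (EuclideanSpace ℝ (Fin n)), IsCompact K → K ⊆ X →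
      ∃ L : ℝ, ∀ x ∈ K, ∀ y ∈ K, ‖gradient u x - gradient u y‖ ≤ L * ‖x - y‖ := by
  obtain ⟨K, hK⟩ := hu_lip
  obtain ⟨w, hw, huw⟩ := hK.extend_real
  have hloc : ∀ x ∈ X, u =ᶠ[nhds x] w := fun x hx => huw.eventuallyEq_of_mem (hXopen.mem_nhds hx)
  obtain ⟨hdiff, hgrad⟩ := differentiableAt_and_lipschitz_gradient_of_minimizer hXopen hXbdd hw
    (fun x hx => huw hx ▸ hu_nonneg x hx) (hu_convex.congr huw)
    (fun v hv => PhiCL_congr hXopen huw ▸ hu_min v hv.1 hv.2.1 hv.2.2)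
  refine ⟨fun x hx => (hloc x hx).differentiableAt_iff.2 (hdiff x hx), fun s hs hsX => ?_⟩
  obtain ⟨L, hL⟩ := hgrad s hs hsX
  refine ⟨L, fun x hx y hy => ?_⟩
  rw [(hloc x (hsX hx)).gradient_eq, (hloc y (hsX hy)).gradient_eq]
  exact hL x hx y hy
end
end

section
/- Let X ⊂ ℝⁿ be a bounded open set and let u : X → ℝ be a nonnegative convex Lipschitz function minimizing Φ[v] := ∫_X ( (1/2)|∇v|² + v − x·∇v ) dx over all nonnegative convex Lipschitz functions on X. Let σ : ℝⁿ → ℝ be an affine function and set S := {x ∈ X : u(x) < σ(x)}. If the closure of S is contained in X, then (1/2) ∫_S |∇u − ∇σ|² dx ≤ (n+1) ∫_S (σ − u) dx. -/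
open MeasureTheory RealInnerProductSpace

noncomputable section

open Set in
/-- A function that is Lipschitz on `X` and vanishes on `X \ S`, where `S` is open with closure
inside `X`, stays Lipschitz with the same constant when extended by zero off `S`. -/
theorem LipschitzOnWith.lipschitzWith_indicator {E : Type*} [NormedAddCommGroup E]
    [NormedSpace ℝ E] {X S : Set E} {f : E → ℝ} {K : NNReal} (hf : LipschitzOnWith K f X)
    (hS : IsOpen S) (hSX : closure S ⊆ X) (hzero : ∀ x ∈ X, x ∉ S → f x = 0) :
    LipschitzWith K (S.indicator f) := by
  have hsub : S ⊆ X := subset_closure.trans hSX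
  have key : ∀ x ∈ S, ∀ y ∉ S, dist (f x) 0 ≤ K * dist x y := by
    intro x hx y hy
    obtain ⟨z, hz, hzS⟩ : ∃ z ∈ segment ℝ x y, z ∈ closure S \ S := by
      by_contra! h
      refine hy ((convex_segment x y).isPreconnected.subset_left_of_subset_union hS
        isClosed_closure.isOpen_compl (disjoint_compl_right.mono_left subset_closure) ?_
        ⟨x, left_mem_segment ℝ x y, hx⟩ (right_mem_segment ℝ x y))
      intro z hz
      by_cases hzc : z ∈ closure S
      · exact Or.inl (by_contra fun hzS => h z hz ⟨hzc, hzS⟩)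
      · exact Or.inr hzc
    have hzX := hSX hzS.1
    calc dist (f x) 0 = dist (f x) (f z) := by rw [hzero z hzX hzS.2]
      _ ≤ K * dist x z := hf.dist_le_mul x (hsub hx) z hzX
      _ ≤ K * dist x y := by
        gcongr
        rw [← dist_add_dist_of_mem_segment hz]
        exact le_add_of_nonneg_right dist_nonneg
  refine LipschitzWith.of_dist_le_mul fun x y => ?_
  by_cases hx : x ∈ S <;> by_cases hy : y ∈ S <;> simp only [hx, hy, not_false_eq_true,
    indicator_of_mem, indicator_of_notMem]
  · exact hf.dist_le_mul x (hsub hx) y (hsub hy)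
  · exact key x hx y hy
  · rw [dist_comm, dist_comm x]
    exact key y hy x hx
  · rw [dist_self]
    positivity

section Gradient

variable {E : Type*} [NormedAddCommGroup E] [InnerProductSpace ℝ E] [CompleteSpace E]

theorem LipschitzWith.norm_gradient_le_s4 {f : E → ℝ} {K : NNReal} (hf : LipschitzWith K f) (x : E) :
    ‖gradient f x‖ ≤ K := by
  rw [gradient, LinearIsometryEquiv.norm_map]
  exact norm_fderiv_le_of_lipschitz ℝ hf

theorem measurable_gradient_s4 [MeasurableSpace E] [BorelSpace E] (f : E → ℝ) :
    Measurable (gradient f) :=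
  (InnerProductSpace.toDual ℝ E).symm.continuous.measurable.comp (measurable_fderiv ℝ f)

theorem HasGradientAt.add {f g : E → ℝ} {a b x : E} (hf : HasGradientAt f a x)
    (hg : HasGradientAt g b x) : HasGradientAt (fun y => f y + g y) (a + b) x := by
  rw [hasGradientAt_iff_hasFDerivAt, map_add]
  exact HasFDerivAt.add hf hg

theorem HasGradientAt.sub {f g : E → ℝ} {a b x : E} (hf : HasGradientAt f a x)
    (hg : HasGradientAt g b x) : HasGradientAt (fun y => f y - g y) (a - b) x := by
  rw [hasGradientAt_iff_hasFDerivAt, map_sub]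
  exact HasFDerivAt.sub hf hg

theorem hasGradientAt_inner_add_const (p : E) (c : ℝ) (x : E) :
    HasGradientAt (fun y => ⟪p, y⟫ + c) p x := by
  rw [hasGradientAt_iff_hasFDerivAt]
  exact ((InnerProductSpace.toDual ℝ E) p).hasFDerivAt.add_const c

theorem IsLocalMin.gradient_eq_zero {f : E → ℝ} {x : E} (h : IsLocalMin f x) :
    gradient f x = 0 := by
  rw [gradient, h.fderiv_eq_zero, map_zero]

theorem gradient_eq_zero_of_notMem_tsupport {f : E → ℝ} {x : E} (h : x ∉ tsupport f) :
    gradient f x = 0 := by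
  rw [(notMem_tsupport_iff_eventuallyEq.mp h).gradient_eq]
  exact gradient_const x 0

end Gradient

section GradientIntegral

variable {E : Type*} [NormedAddCommGroup E] [InnerProductSpace ℝ E] [FiniteDimensional ℝ E]
  [MeasurableSpace E] [BorelSpace E] {μ : Measure E}

theorem LipschitzWith.integrableOn_inner_gradient [IsFiniteMeasureOnCompacts μ] {f : E → ℝ}
    {K : NNReal} (hf : LipschitzWith K f) {g : E → E} (hg : Continuous g) {s : Set E}
    (hs : IsCompact s) : IntegrableOn (fun x => ⟪g x, gradient f x⟫) s μ := by
  obtain ⟨C, hC⟩ := hs.exists_bound_of_continuousOn hg.continuousOn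
  refine Measure.integrableOn_of_bounded (M := C * K) hs.measure_lt_top.ne
    (hg.measurable.inner (measurable_gradient_s4 f)).aestronglyMeasurable ?_
  filter_upwards [ae_restrict_mem hs.measurableSet] with x hx
  exact (norm_inner_le_norm _ _).trans (mul_le_mul (hC x hx) (hf.norm_gradient_le_s4 x)
    (norm_nonneg _) ((norm_nonneg _).trans (hC x hx)))

theorem LipschitzWith.integrableOn_norm_gradient_sq [IsFiniteMeasureOnCompacts μ] {f : E → ℝ}
    {K : NNReal} (hf : LipschitzWith K f) {s : Set E} (hs : IsCompact s) :
    IntegrableOn (fun x => ‖gradient f x‖ ^ 2) s μ := by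
  refine Measure.integrableOn_of_bounded (M := (K : ℝ) ^ 2) hs.measure_lt_top.ne
    ((measurable_gradient_s4 f).norm.pow_const 2).aestronglyMeasurable (ae_of_all _ fun x => ?_)
  rw [norm_pow, norm_norm]
  gcongr
  exact hf.norm_gradient_le_s4 x

/-- Integration by parts of a compactly supported Lipschitz function against the field `x - p`,
whose divergence is the dimension. -/
theorem LipschitzWith.integral_inner_sub_gradient [μ.IsAddHaarMeasure] {f : E → ℝ} {K : NNReal}
    (hf : LipschitzWith K f) (hfc : HasCompactSupport f) (p : E) :
    ∫ x, ⟪x - p, gradient f x⟫ ∂μ = -(Module.finrank ℝ E * ∫ x, f x ∂μ) := by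
  let b := stdOrthonormalBasis ℝ E
  have hdir (i) : ∫ x, ⟪x - p, b i⟫ * ⟪b i, gradient f x⟫ ∂μ = -∫ x, f x ∂μ := by
    have hlip : LipschitzWith ‖innerSL ℝ (b i)‖₊ (fun x => ⟪x - p, b i⟫) := by
      have := (innerSL ℝ (b i)).lipschitz.comp (LipschitzWith.id.sub (LipschitzWith.const p))
      simpa [Function.comp_def, real_inner_comm] using this
    have hline (x : E) : lineDeriv ℝ (fun x => ⟪x - p, b i⟫) x (-b i) = -1 := by
      have h : HasFDerivAt (fun x => ⟪x - p, b i⟫) (innerSL ℝ (b i)) x := by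
        have := (innerSL ℝ (b i)).hasFDerivAt.comp x ((hasFDerivAt_id x).sub_const p)
        simpa [Function.comp_def, real_inner_comm] using this
      rw [h.differentiableAt.lineDeriv_eq_fderiv, h.fderiv]
      simp
    have hparts := hlip.integral_lineDeriv_mul_eq (μ := μ) hf hfc (-b i)
    simp only [hline, neg_neg, neg_one_mul, integral_neg] at hparts
    rw [hparts]
    refine integral_congr_ae ?_
    filter_upwards [hf.ae_differentiableAt (μ := μ)] with x hx
    rw [hx.lineDeriv_eq_fderiv, real_inner_comm (gradient f x), inner_gradient_left, mul_comm]
  have hint (i) : Integrable (fun x => ⟪x - p, b i⟫ * ⟪b i, gradient f x⟫) μ := by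
    have h := hf.integrableOn_inner_gradient (μ := μ)
      (g := fun x => ⟪x - p, b i⟫ • b i) (by fun_prop) hfc.isCompact
    simp only [real_inner_smul_left] at h
    refine h.integrable_of_forall_notMem_eq_zero fun x hx => ?_
    rw [gradient_eq_zero_of_notMem_tsupport hx, inner_zero_right, mul_zero]
  rw [funext fun x => (b.sum_inner_mul_inner (x - p) (gradient f x)).symm,
    integral_finsetSum _ fun i _ => hint i]
  simp_rw [hdir]
  simp

end GradientIntegral

/-- **Energy comparison estimate.** If `u` is a nonnegative convex Lipschitz minimizer of
`Φ` on the bounded open set `X`, `σ` is affine, and the section `S = {x ∈ X : u < σ}`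
is compactly contained in `X`, then `½∫_S |∇u - ∇σ|² ≤ (n+1) ∫_S (σ - u)`. -/
theorem energy_comparison {n : ℕ} (X : Set (EuclideanSpace ℝ (Fin n)))
    (hXopen : IsOpen X) (hXbdd : Bornology.IsBounded X)
    (u : EuclideanSpace ℝ (Fin n) → ℝ)
    (hu_nonneg : ∀ x ∈ X, 0 ≤ u x)
    (hu_convex : ConvexOn ℝ X u)
    (hu_lip : ∃ K : NNReal, LipschitzOnWith K u X)
    (hu_min : ∀ v : EuclideanSpace ℝ (Fin n) → ℝ,
      (∀ x ∈ X, 0 ≤ v x) → ConvexOn ℝ X v → (∃ K : NNReal, LipschitzOnWith K v X) →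
      PhiCL X u ≤ PhiCL X v)
    (σ : EuclideanSpace ℝ (Fin n) → ℝ)
    (hσ : ∃ (p : EuclideanSpace ℝ (Fin n)) (c₀ : ℝ), ∀ x, σ x = ⟪p, x⟫ + c₀)
    (S : Set (EuclideanSpace ℝ (Fin n))) (hS : S = {x ∈ X | u x < σ x})
    (hScc : closure S ⊆ X) :
    1 / 2 * ∫ x in S, ‖gradient u x - gradient σ x‖ ^ 2 ≤
      (n + 1) * ∫ x in S, (σ x - u x) := by
  obtain ⟨K, hK⟩ := hu_lip
  obtain ⟨U, hU, hUu⟩ := hK.extend_real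
  obtain ⟨p, c, hσ⟩ := hσ
  obtain rfl : σ = fun x => ⟪p, x⟫ + c := funext hσ
  have hσgrad (x) : gradient (fun x => ⟪p, x⟫ + c) x = p :=
    (hasGradientAt_inner_add_const p c x).gradient
  have hσlip : LipschitzWith ‖innerSL ℝ p‖₊ (fun x => ⟪p, x⟫ + c) := by
    simpa using (innerSL ℝ p).lipschitz.add (LipschitzWith.const c)
  have hSX : S ⊆ X := subset_closure.trans hScc
  have hSopen : IsOpen S := by
    have h : S = X ∩ {x | U x < ⟪p, x⟫ + c} := by
      ext x
      simp only [hS, Set.mem_ofPred_eq, Set.mem_inter_iff]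
      exact and_congr_right fun hx => by rw [hUu hx]
    rw [h]
    exact hXopen.inter (isOpen_lt hU.continuous hσlip.continuous)
  have hmaxlip := (hσlip.sub hU).max_const 0
  set w : EuclideanSpace ℝ (Fin n) → ℝ :=
    S.indicator fun x => max (⟪p, x⟫ + c - U x) 0 with hw
  have hwlip : LipschitzWith (‖innerSL ℝ p‖₊ + K) w := by
    refine (hmaxlip.lipschitzOnWith (s := X)).lipschitzWith_indicator hSopen hScc ?_
    intro x hx hxS
    rw [hS] at hxS
    refine max_eq_right (sub_nonpos.mpr ?_)
    rw [← hUu hx]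
    exact not_lt.mp fun h => hxS ⟨hx, h⟩
  have hwnonneg (x) : 0 ≤ w x := Set.indicator_nonneg (fun _ _ => le_max_right _ _) x
  have hwzero (x) (hx : x ∉ S) : w x = 0 := Set.indicator_of_notMem hx _
  have hwS (x) (hx : x ∈ S) : w x = ⟪p, x⟫ + c - u x := by
    have hlt := hx
    rw [hS] at hlt
    rw [hw, Set.indicator_of_mem hx, ← hUu (hSX hx)]
    exact max_eq_left (sub_nonneg.mpr hlt.2.le)
  have hcompact : IsCompact (closure X) := hXbdd.isCompact_closure
  have hwsupp : HasCompactSupport w :=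
    HasCompactSupport.intro hcompact fun x hx => hwzero x fun h => hx (subset_closure (hSX h))
  have hgrad_zero (x) (hx : x ∉ S) : gradient w x = 0 :=
    IsLocalMin.gradient_eq_zero (Filter.Eventually.of_forall fun y => by
      rw [hwzero x hx]
      exact hwnonneg y)
  have hgradU (x) (hx : x ∈ X) : gradient u x = gradient U x :=
    (hUu.eventuallyEq_of_mem (hXopen.mem_nhds hx)).gradient_eq
  have hgradS : ∀ᵐ x, x ∈ S → gradient w x = p - gradient u x := by
    filter_upwards [hU.ae_differentiableAt] with x hx hxS
    have hwx : w =ᶠ[nhds x] fun y => (⟪p, y⟫ + c) - U y := by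
      filter_upwards [hSopen.mem_nhds hxS] with y hy
      rw [hwS y hy, hUu (hSX hy)]
    rw [hwx.gradient_eq, hgradU x (hSX hxS)]
    exact ((hasGradientAt_inner_add_const p c x).sub hx.hasGradientAt).gradient
  let v := fun x => u x ⊔ (⟪p, x⟫ + c)
  have hvw (x) (hx : x ∈ X) : v x = U x + w x := by
    rw [← hUu hx]
    by_cases hxS : x ∈ S
    · rw [hwS x hxS, add_sub_cancel]
      rw [hS] at hxS
      exact max_eq_right hxS.2.le
    · rw [hwzero x hxS, add_zero]
      rw [hS] at hxS
      exact max_eq_left (not_lt.mp fun h => hxS ⟨hx, h⟩)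
  have hmin : PhiCL X u ≤ PhiCL X v := by
    refine hu_min v (fun x hx => (hu_nonneg x hx).trans (le_max_left _ _)) ?_ ?_
    · refine hu_convex.sup ?_
      exact ((innerSL ℝ p).toLinearMap.convexOn hu_convex.1).add_const c
    · refine ⟨K + (‖innerSL ℝ p‖₊ + K), fun x hx y hy => ?_⟩
      rw [hvw x hx, hvw y hy]
      exact hU.add hwlip x y
  have hXm := hXopen.measurableSet
  have hwint : IntegrableOn w X :=
    (hwlip.continuous.continuousOn.integrableOn_compact hcompact).mono_set subset_closure
  have hsqint : IntegrableOn (fun x => ‖gradient w x‖ ^ 2) X :=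
    (hwlip.integrableOn_norm_gradient_sq hcompact).mono_set subset_closure
  have hdivint : IntegrableOn (fun x => ⟪x - p, gradient w x⟫) X :=
    (hwlip.integrableOn_inner_gradient (by fun_prop) hcompact).mono_set subset_closure
  have huint : IntegrableOn
      (fun x => 1 / 2 * ‖gradient u x‖ ^ 2 + u x - ⟪x, gradient u x⟫) X := by
    have h : IntegrableOn
        (fun x => 1 / 2 * ‖gradient U x‖ ^ 2 + U x - ⟪x, gradient U x⟫) (closure X) :=
      (((hU.integrableOn_norm_gradient_sq hcompact).const_mul _).add
        (hU.continuous.continuousOn.integrableOn_compact hcompact)).sub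
        (hU.integrableOn_inner_gradient continuous_id hcompact)
    refine (h.mono_set subset_closure).congr_fun (fun x hx => ?_) hXm
    simp only [hgradU x hx, hUu hx]
  have hwsqint : IntegrableOn (fun x => w x - 1 / 2 * ‖gradient w x‖ ^ 2) X :=
    hwint.sub (hsqint.const_mul _)
  have hvarint : IntegrableOn
      (fun x => w x - 1 / 2 * ‖gradient w x‖ ^ 2 - ⟪x - p, gradient w x⟫) X :=
    hwsqint.sub hdivint
  have hPhi : PhiCL X v = PhiCL X u +
      ∫ x in X, (w x - 1 / 2 * ‖gradient w x‖ ^ 2 - ⟪x - p, gradient w x⟫) := by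
    rw [PhiCL, PhiCL, ← integral_add huint hvarint]
    refine setIntegral_congr_ae hXm ?_
    filter_upwards [hU.ae_differentiableAt, hwlip.ae_differentiableAt, hgradS]
      with x hUx hwx hxS hx
    have hv : gradient v x = gradient u x + gradient w x := by
      have heq : v =ᶠ[nhds x] fun y => U y + w y := by
        filter_upwards [hXopen.mem_nhds hx] with y hy using hvw y hy
      rw [heq.gradient_eq, hgradU x hx]
      exact (hUx.hasGradientAt.add hwx.hasGradientAt).gradient
    rw [hv, hvw x hx, ← hUu hx]
    by_cases h : x ∈ S
    · have hp : p = gradient u x + gradient w x := by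
        rw [hxS h]
        abel
      rw [hp, norm_add_sq_real, inner_add_right, inner_sub_left, inner_add_left,
        real_inner_self_eq_norm_sq]
      ring
    · rw [hgrad_zero x h, hwzero x h]
      simp
  rw [hPhi, integral_sub hwsqint hdivint,
    integral_sub hwint (hsqint.const_mul _), integral_const_mul] at hmin
  have hdiv : ∫ x in X, ⟪x - p, gradient w x⟫ = -(n * ∫ x in S, (⟪p, x⟫ + c - u x)) := by
    rw [setIntegral_eq_integral_of_forall_compl_eq_zero fun x hx => by
      rw [hgrad_zero x fun h => hx (hSX h), inner_zero_right],
      hwlip.integral_inner_sub_gradient hwsupp, finrank_euclideanSpace_fin,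
      ← setIntegral_eq_integral_of_forall_compl_eq_zero hwzero,
      setIntegral_congr_fun hSopen.measurableSet hwS]
  have hmass : ∫ x in X, w x = ∫ x in S, (⟪p, x⟫ + c - u x) := by
    rw [setIntegral_eq_of_subset_of_forall_sdiff_eq_zero hXm hSX fun x hx => hwzero x hx.2,
      setIntegral_congr_fun hSopen.measurableSet hwS]
  have henergy : ∫ x in X, ‖gradient w x‖ ^ 2 =
      ∫ x in S, ‖gradient u x - gradient (fun x => ⟪p, x⟫ + c) x‖ ^ 2 := by
    rw [setIntegral_eq_of_subset_of_forall_sdiff_eq_zero hXm hSX fun x hx => by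
      rw [hgrad_zero x hx.2, norm_zero, zero_pow two_ne_zero]]
    refine setIntegral_congr_ae hSopen.measurableSet ?_
    filter_upwards [hgradS] with x hx hxS
    rw [hx hxS, hσgrad, norm_sub_rev]
  rw [hdiv, hmass, henergy] at hmin
  linarith
end
end

section
/- There is a dimensional constant c(n) > 0 with the following property. Let Ω ⊂ ℝⁿ be open, let u : Ω → ℝ be convex and Lipschitz, let σ : ℝⁿ → ℝ be affine, and set S := {x ∈ Ω : u(x) < σ(x)}. Suppose that: the closure of S is contained in Ω; 0 ∈ S and σ(0) − u(0) ≥ h/2 for some h > 0; and S ⊂ {x : |⟨x,e₁⟩| ≤ r} for some r > 0. Then ∫_S |∇u − ∇σ|² dx ≥ c(n) (h²/r²) |S|. -/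
open MeasureTheory RealInnerProductSpace

noncomputable section

open Set Pointwise

/-- Quantitative Cauchy–Schwarz on an interval: an absolutely continuous function dropping by at
least `m` on an interval of length at most `L` has Dirichlet energy at least `m ^ 2 / L`. -/
theorem AbsolutelyContinuousOnInterval.le_lintegral_sq_deriv {f : ℝ → ℝ} {b L m : ℝ}
    (hf : AbsolutelyContinuousOnInterval f 0 b) (hb : 0 ≤ b) (hbL : b ≤ L) (hL : 0 < L)
    (hm : 0 ≤ m) (hdrop : m ≤ f b - f 0) :
    ENNReal.ofReal (m ^ 2 / L) ≤ ∫⁻ t in Ioc 0 b, ENNReal.ofReal (deriv f t ^ 2) := by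
  set g : ℝ → ℝ := fun t ↦ 2 * (m / L) * deriv f t - (m / L) ^ 2
  have hint := hf.intervalIntegrable_deriv
  have hg : IntegrableOn g (Ioc 0 b) := by
    have := (hint.const_mul (2 * (m / L))).sub
      (intervalIntegrable_const (c := (m / L) ^ 2) (μ := volume) (a := 0) (b := b))
    exact (intervalIntegrable_iff_integrableOn_Ioc_of_le hb).1 this
  have hval : ∫ t in Ioc 0 b, g t = 2 * (m / L) * (f b - f 0) - b * (m / L) ^ 2 := by
    rw [← intervalIntegral.integral_of_le hb, intervalIntegral.integral_sub
      (hint.const_mul _) intervalIntegrable_const, intervalIntegral.integral_const_mul,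
      hf.integral_deriv_eq_sub]
    simp
  have hle : m ^ 2 / L ≤ ∫ t in Ioc 0 b, g t := by
    have hk : 0 ≤ m / L := by positivity
    have hkL : m / L * L = m := by field_simp
    have h1 : m ^ 2 / L = m / L * m := by ring
    rw [hval, h1]
    nlinarith [mul_le_mul_of_nonneg_left hdrop hk,
      mul_le_mul_of_nonneg_right hbL (sq_nonneg (m / L))]
  calc ENNReal.ofReal (m ^ 2 / L) ≤ ENNReal.ofReal (∫ t in Ioc 0 b, g t) :=
        ENNReal.ofReal_le_ofReal hle
    _ ≤ ∫⁻ t in Ioc 0 b, ENNReal.ofReal (g t) := by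
        rw [integral_eq_lintegral_pos_part_sub_lintegral_neg_part hg]
        exact (ENNReal.ofReal_le_ofReal (sub_le_self _ ENNReal.toReal_nonneg)).trans
          ENNReal.ofReal_toReal_le
    _ ≤ ∫⁻ t in Ioc 0 b, ENNReal.ofReal (deriv f t ^ 2) := by
        refine lintegral_mono fun t ↦ ENNReal.ofReal_le_ofReal ?_
        simp only [g]
        nlinarith [sq_nonneg (deriv f t - m / L)]

section Translation

variable {E : Type*} [NormedAddCommGroup E] [NormedSpace ℝ E] [FiniteDimensional ℝ E]
  [MeasurableSpace E] [BorelSpace E] {μ : Measure E} [μ.IsAddHaarMeasure]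

/-- A property holding almost everywhere holds almost everywhere on almost every line of a given
direction. -/
theorem ae_ae_line_of_ae {p : E → Prop} (hp : MeasurableSet {x | p x}) (h : ∀ᵐ x ∂μ, p x)
    (e : E) : ∀ᵐ x ∂μ, ∀ᵐ t : ℝ, p (x + t • e) := by
  have hmeas : Measurable fun q : E × ℝ ↦ q.1 + q.2 • e := by fun_prop
  refine (Measure.ae_ae_comm (p := fun x (t : ℝ) ↦ p (x + t • e)) (hmeas hp)).2
    (.of_forall fun t ↦ ?_)
  exact (measurePreserving_add_right μ (t • e)).quasiMeasurePreserving.ae h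

/-- If the integrals of `g` over the translates of a fixed segment `I • e` starting in `A` are at
least `C`, then `g` has total integral at least `C * μ A / |I|`. -/
theorem mul_measure_le_of_le_lintegral_line {g : E → ENNReal} (hg : Measurable g) {A : Set E}
    {C : ENNReal} {I : Set ℝ} {e : E}
    (h : ∀ᵐ x ∂μ, x ∈ A → C ≤ ∫⁻ t in I, g (x + t • e)) :
    C * μ A ≤ volume I * ∫⁻ x, g x ∂μ := by
  have hmeas : Measurable fun q : E × ℝ ↦ g (q.1 + q.2 • e) := by fun_prop
  calc C * μ A = ∫⁻ _ in A, C ∂μ := (setLIntegral_const A C).symm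
    _ ≤ ∫⁻ x in A, (∫⁻ t in I, g (x + t • e)) ∂μ :=
        setLIntegral_mono_ae hmeas.lintegral_prod_right'.aemeasurable h
    _ ≤ ∫⁻ x, (∫⁻ t in I, g (x + t • e)) ∂μ := setLIntegral_le_lintegral _ _
    _ = ∫⁻ t in I, (∫⁻ x, g (x + t • e) ∂μ) := lintegral_lintegral_swap hmeas.aemeasurable
    _ = ∫⁻ _ in I, (∫⁻ x, g x ∂μ) := by simp_rw [lintegral_add_right_eq_self g]
    _ = volume I * ∫⁻ x, g x ∂μ := by rw [setLIntegral_const, mul_comm]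

end Translation

/-- A line segment leaving an open set `S` has a first exit time. -/
theorem IsOpen.exists_first_exit {E : Type*} [NormedAddCommGroup E] [NormedSpace ℝ E]
    {S : Set E} (hS : IsOpen S) {x e : E} (hx : x ∈ S) {L : ℝ} (hL : 0 ≤ L)
    (hexit : x + L • e ∉ S) :
    ∃ b, 0 < b ∧ b ≤ L ∧ x + b • e ∉ S ∧ (∀ t ∈ Ico 0 b, x + t • e ∈ S) ∧
      ∀ t ∈ Icc 0 b, x + t • e ∈ closure S := by
  have hcont : Continuous fun t : ℝ ↦ x + t • e := by fun_prop
  set J : Set ℝ := Ici 0 ∩ (fun t : ℝ ↦ x + t • e) ⁻¹' Sᶜ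
  have hJc : IsClosed J := isClosed_Ici.inter (hS.isClosed_compl.preimage hcont)
  have hLJ : L ∈ J := ⟨hL, hexit⟩
  have hJb : BddBelow J := ⟨0, fun t ht ↦ ht.1⟩
  have hbJ : sInf J ∈ J := hJc.csInf_mem ⟨L, hLJ⟩ hJb
  have hb : 0 < sInf J := by
    refine lt_of_le_of_ne hbJ.1 fun h0 ↦ hbJ.2 ?_
    simpa [← h0] using hx
  have hIco : ∀ t ∈ Ico 0 (sInf J), x + t • e ∈ S := fun t ht ↦ by
    by_contra hn
    exact (csInf_le hJb ⟨ht.1, hn⟩).not_gt ht.2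
  refine ⟨sInf J, hb, csInf_le hJb hLJ, hbJ.2, hIco, fun t ht ↦ ?_⟩
  rw [← closure_Ico hb.ne] at ht
  exact map_mem_closure (f := fun t : ℝ ↦ x + t • e) hcont ht hIco

/-- Lower bound on the energy of a Lipschitz function `w` along a segment starting in its
sublevel set `{w < 0}`. -/
theorem LipschitzOnWith.le_lintegral_line_sq_norm_fderiv {E : Type*} [NormedAddCommGroup E]
    [NormedSpace ℝ E] {Ω S : Set E} {w : E → ℝ} {K : NNReal} (hΩ : IsOpen Ω)
    (hw : LipschitzOnWith K w Ω) (hS : S = {x ∈ Ω | w x < 0}) (hSΩ : closure S ⊆ Ω)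
    {x e : E} (he : ‖e‖ ≤ 1) {L m : ℝ} (hL : 0 < L) (hm : 0 < m) (hxΩ : x ∈ Ω) (hx : w x ≤ -m)
    (hexit : x + L • e ∉ S)
    (hdiff : ∀ᵐ t : ℝ, x + t • e ∈ S → DifferentiableAt ℝ w (x + t • e)) :
    ENNReal.ofReal (m ^ 2 / L) ≤
      ∫⁻ t in Icc 0 L, S.indicator (fun y ↦ ENNReal.ofReal (‖fderiv ℝ w y‖ ^ 2)) (x + t • e) := by
  have hSo : IsOpen S := by
    rw [hS]; exact hw.continuousOn.isOpen_inter_preimage hΩ isOpen_Iio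
  have hxS : x ∈ S := by rw [hS]; exact ⟨hxΩ, by linarith⟩
  obtain ⟨b, hb, hbL, hbS, hIco, hIcc⟩ := hSo.exists_first_exit hxS hL.le hexit
  set f : ℝ → ℝ := fun t ↦ w (x + t • e)
  have hline : LipschitzWith ‖e‖₊ fun t : ℝ ↦ x + t • e := by
    refine LipschitzWith.of_dist_le_mul fun s t ↦ ?_
    rw [dist_add_left, dist_eq_norm, ← sub_smul, norm_smul, mul_comm, dist_eq_norm, coe_nnnorm]
  have hf : AbsolutelyContinuousOnInterval f 0 b := by
    refine LipschitzOnWith.absolutelyContinuousOnInterval (K := K * ‖e‖₊) ?_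
    rw [uIcc_of_le hb.le]
    exact hw.comp (hline.lipschitzOnWith (s := Icc 0 b)) fun t ht ↦ hSΩ (hIcc t ht)
  have hfb : 0 ≤ f b := by
    by_contra hlt
    exact hbS (hS ▸ ⟨hSΩ (hIcc b ⟨hb.le, le_rfl⟩), not_le.1 hlt⟩)
  have hf0 : f 0 ≤ -m := by simpa [f] using hx
  refine (hf.le_lintegral_sq_deriv hb.le hbL hL hm.le (by linarith)).trans ?_
  rw [← restrict_Ioo_eq_restrict_Ioc]
  refine le_trans ?_ (lintegral_mono_set (Ioo_subset_Icc_self.trans (Icc_subset_Icc_right hbL)))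
  refine setLIntegral_mono_ae' measurableSet_Ioo ?_
  filter_upwards [hdiff] with t ht htb
  have htS := hIco t ⟨htb.1.le, htb.2⟩
  rw [indicator_of_mem htS]
  refine ENNReal.ofReal_le_ofReal (sq_le_sq.2 ?_)
  have hd : HasDerivAt f (fderiv ℝ w (x + t • e) e) t := by
    have h1 : HasDerivAt (fun t : ℝ ↦ x + t • e) e t := by
      simpa using ((hasDerivAt_id t).smul_const e).const_add x
    exact (ht htS).hasFDerivAt.comp_hasDerivAt t h1
  rw [hd.deriv, abs_norm, ← Real.norm_eq_abs]
  exact ((fderiv ℝ w (x + t • e)).le_opNorm e).trans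
    (mul_le_of_le_one_right (norm_nonneg _) he)

/-- Lower bound on the Dirichlet energy of a convex Lipschitz function over its sublevel set
`{w < 0}`, when this set is contained in a slab. -/
theorem ConvexOn.le_setLIntegral_sq_norm_fderiv {E : Type*} [NormedAddCommGroup E]
    [InnerProductSpace ℝ E] [FiniteDimensional ℝ E] [MeasurableSpace E] [BorelSpace E]
    {μ : Measure E} [μ.IsAddHaarMeasure] {Ω S : Set E} {w : E → ℝ} {K : NNReal} (hΩ : IsOpen Ω)
    (hconv : ConvexOn ℝ Ω w) (hw : LipschitzOnWith K w Ω) (hS : S = {x ∈ Ω | w x < 0})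
    (hSΩ : closure S ⊆ Ω) {e : E} (he : ‖e‖ = 1) {h r : ℝ} (hh : 0 < h) (hr : 0 < r)
    (h0S : 0 ∈ S) (h0 : w 0 ≤ -(h / 2)) (hslab : ∀ x ∈ S, |⟪x, e⟫| ≤ r) :
    ENNReal.ofReal ((1 / 2) ^ Module.finrank ℝ E / 144 * (h ^ 2 / r ^ 2)) * μ S ≤
      ∫⁻ x in S, ENNReal.ofReal (‖fderiv ℝ w x‖ ^ 2) ∂μ := by
  have hSo : IsOpen S := by
    rw [hS]; exact hw.continuousOn.isOpen_inter_preimage hΩ isOpen_Iio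
  have hSsub : S ⊆ Ω := subset_closure.trans hSΩ
  have hdiff : ∀ᵐ x ∂μ, x ∈ S → DifferentiableAt ℝ w x := by
    filter_upwards [(hw.mono hSsub).ae_differentiableWithinAt_of_mem (μ := μ)] with x hx hxS
    exact (hx hxS).differentiableAt (hSo.mem_nhds hxS)
  have hpm : MeasurableSet {x | x ∈ S → DifferentiableAt ℝ w x} := by
    have : {x | x ∈ S → DifferentiableAt ℝ w x} = Sᶜ ∪ {x | DifferentiableAt ℝ w x} := by
      ext x; simp [imp_iff_not_or]
    rw [this]
    exact hSo.measurableSet.compl.union (measurableSet_of_differentiableAt ℝ w)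
  set g : E → ENNReal := S.indicator fun y ↦ ENNReal.ofReal (‖fderiv ℝ w y‖ ^ 2)
  have hg : Measurable g :=
    (((measurable_fderiv ℝ w).norm.pow_const 2).ennreal_ofReal).indicator hSo.measurableSet
  have hkey : ∀ᵐ x ∂μ, x ∈ (1 / 2 : ℝ) • S →
      ENNReal.ofReal ((h / 4) ^ 2 / (3 * r)) ≤ ∫⁻ t in Icc 0 (3 * r), g (x + t • e) := by
    filter_upwards [ae_ae_line_of_ae hpm hdiff e] with x hx hxA
    obtain ⟨y, hy, rfl⟩ := hxA
    have hyS := hS ▸ hy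
    have hx' : (1 / 2 : ℝ) • y ∈ Ω ∧ w ((1 / 2 : ℝ) • y) ≤ -(h / 4) := by
      have hc1 : (1 / 2 : ℝ) • (0 : E) + (1 / 2 : ℝ) • y ∈ Ω :=
        hconv.1 (hSsub h0S) hyS.1 (by norm_num) (by norm_num) (by norm_num)
      have hc2 : w ((1 / 2 : ℝ) • (0 : E) + (1 / 2 : ℝ) • y) ≤
          (1 / 2 : ℝ) • w 0 + (1 / 2 : ℝ) • w y := hconv.2 (hSsub h0S) hyS.1
        (by norm_num) (by norm_num) (by norm_num)
      rw [smul_zero, zero_add] at hc1 hc2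
      simp only [smul_eq_mul] at hc2
      exact ⟨hc1, by linarith [hyS.2]⟩
    refine hw.le_lintegral_line_sq_norm_fderiv hΩ hS hSΩ he.le (by positivity) (by positivity)
      hx'.1 hx'.2 (fun hmem ↦ ?_) hx
    have h1 := hslab _ hmem
    have h2 := hslab _ hy
    rw [inner_add_left, real_inner_smul_left, real_inner_smul_left, real_inner_self_eq_norm_sq,
      he] at h1
    rw [abs_le] at h1 h2
    linarith [h1.2, h2.1]
  have hmain := mul_measure_le_of_le_lintegral_line hg hkey
  rw [Measure.addHaar_smul, lintegral_indicator hSo.measurableSet, Real.volume_Icc, sub_zero,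
    abs_of_pos (by positivity), ← mul_assoc, ← ENNReal.ofReal_mul (by positivity)] at hmain
  have h3r : ENNReal.ofReal (3 * r) ≠ 0 := by simpa using hr
  refine (ENNReal.mul_le_mul_iff_right h3r ENNReal.ofReal_ne_top).1 ?_
  rw [← mul_assoc, ← ENNReal.ofReal_mul (by positivity)]
  convert hmain using 3
  field_simp
  norm_num

/-- **Lower bound on the Dirichlet excess over a section.** There is a dimensional
constant `c(n) > 0` such that, for a convex Lipschitz `u` on an open set `Ω`, an affine
`σ`, and the section `S = {x ∈ Ω : u < σ}` compactly contained in `Ω`, if `0 ∈ S` with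
`σ(0) - u(0) ≥ h/2` and `S` lies in the slab `{|x¹| ≤ r}`, then
`∫_S |∇u - ∇σ|² ≥ c(n) (h²/r²) |S|`. -/
theorem dirichlet_lower_bound (n : ℕ) (hn : 1 ≤ n) :
    ∃ c : ℝ, 0 < c ∧
      ∀ (Ω : Set (EuclideanSpace ℝ (Fin n))), IsOpen Ω →
      ∀ (u : EuclideanSpace ℝ (Fin n) → ℝ), ConvexOn ℝ Ω u →
        (∃ K : NNReal, LipschitzOnWith K u Ω) →
      ∀ (σ : EuclideanSpace ℝ (Fin n) → ℝ),
        (∃ (p : EuclideanSpace ℝ (Fin n)) (c₀ : ℝ), ∀ x, σ x = ⟪p, x⟫ + c₀) →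
      ∀ (S : Set (EuclideanSpace ℝ (Fin n))), S = {x ∈ Ω | u x < σ x} →
        closure S ⊆ Ω →
      ∀ (h : ℝ), 0 < h → (0 : EuclideanSpace ℝ (Fin n)) ∈ S →
        h / 2 ≤ σ 0 - u 0 →
      ∀ (r : ℝ), 0 < r →
        S ⊆ {x | |⟪x, EuclideanSpace.single (⟨0, hn⟩ : Fin n) (1:ℝ)⟫| ≤ r} →
      c * (h ^ 2 / r ^ 2) * (volume S).toReal ≤
        ∫ x in S, ‖gradient u x - gradient σ x‖ ^ 2 := by
  refine ⟨(1 / 2) ^ n / 144, by positivity, ?_⟩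
  rintro Ω hΩ u hu ⟨K, hK⟩ σ ⟨p, c₀, hσ⟩ S hS hSΩ h hh h0S h0 r hr hslab
  set c : ℝ := (1 / 2) ^ n / 144 * (h ^ 2 / r ^ 2)
  have hσgrad : ∀ x, HasGradientAt σ p x := fun x ↦ by
    rw [hasGradientAt_iff_hasFDerivAt, funext hσ]
    exact (InnerProductSpace.toDual ℝ _ p).hasFDerivAt.add_const c₀
  have hσlip : LipschitzWith ‖p‖₊ σ := by
    refine LipschitzWith.of_dist_le_mul fun x y ↦ ?_
    rw [hσ, hσ, dist_add_right, dist_eq_norm, ← inner_sub_right, dist_eq_norm]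
    exact norm_inner_le_norm p (x - y)
  set w : EuclideanSpace ℝ (Fin n) → ℝ := fun x ↦ u x - σ x
  have hwconv : ConvexOn ℝ Ω w := by
    refine hu.sub ⟨hu.1, fun x _ y _ a b _ _ hab ↦ le_of_eq ?_⟩
    simp only [hσ, inner_add_right, real_inner_smul_right, smul_eq_mul]
    linear_combination c₀ * hab
  have hwlip : LipschitzOnWith (K + ‖p‖₊) w Ω := hK.sub hσlip.lipschitzOnWith
  have hSw : S = {x ∈ Ω | w x < 0} := by simp only [hS, w, sub_neg]
  have hSo : IsOpen S := by
    rw [hSw]; exact hwlip.continuousOn.isOpen_inter_preimage hΩ isOpen_Iio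
  have hSsub : S ⊆ Ω := subset_closure.trans hSΩ
  have henergy : ENNReal.ofReal c * volume S ≤
      ∫⁻ x in S, ENNReal.ofReal (‖fderiv ℝ w x‖ ^ 2) := by
    have := hwconv.le_setLIntegral_sq_norm_fderiv (μ := volume) hΩ hwlip hSw hSΩ
      (e := EuclideanSpace.single (⟨0, hn⟩ : Fin n) (1 : ℝ)) (by simp) hh hr h0S
      (by simp only [w]; linarith) hslab
    rwa [finrank_euclideanSpace_fin] at this
  have hgrad : ∫ x in S, ‖gradient u x - gradient σ x‖ ^ 2 = ∫ x in S, ‖fderiv ℝ w x‖ ^ 2 := by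
    refine setIntegral_congr_ae hSo.measurableSet ?_
    filter_upwards [(hK.mono hSsub).ae_differentiableWithinAt_of_mem (μ := volume)] with x hx hxS
    have hux := ((hx hxS).differentiableAt (hSo.mem_nhds hxS)).hasGradientAt
    have hwx : HasFDerivAt w _ x := hux.hasFDerivAt.sub (hσgrad x).hasFDerivAt
    rw [hwx.fderiv, (hσgrad x).gradient, ← map_sub, LinearIsometryEquiv.norm_map]
  rw [hgrad]
  rcases eq_or_ne (volume S) ⊤ with htop | hfin
  · rw [htop, ENNReal.toReal_top, mul_zero]
    exact integral_nonneg fun x ↦ by positivity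
  have hlt : ∫⁻ x in S, ENNReal.ofReal (‖fderiv ℝ w x‖ ^ 2) ≠ ⊤ := by
    refine ne_top_of_le_ne_top (ENNReal.mul_ne_top ENNReal.ofReal_ne_top hfin)
      (b := ENNReal.ofReal ((K + ‖p‖₊ : NNReal) ^ 2) * volume S) ?_
    rw [← setLIntegral_const]
    refine setLIntegral_mono' hSo.measurableSet fun x hx ↦ ENNReal.ofReal_le_ofReal ?_
    have := norm_fderiv_le_of_lipschitzOn ℝ (hΩ.mem_nhds (hSsub hx)) hwlip
    gcongr
  rw [integral_eq_lintegral_of_nonneg_ae (.of_forall fun x ↦ by positivity)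
    ((measurable_fderiv ℝ w).norm.pow_const 2).aestronglyMeasurable]
  refine le_trans (le_of_eq ?_) (ENNReal.toReal_mono hlt henergy)
  rw [ENNReal.toReal_mul, ENNReal.toReal_ofReal (by positivity)]
end
end
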